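/- arXiv:2306.14833 — 3 statements merged into one kernel-verified Lean document; each statement's English description precedes it below -/
import Mathlib

section
/- Let F be a field and let D be a local subring of F. A subring R of F with D ⊆ R is a local ring that dominates D, is residually algebraic over D, and is integrally closed in F if and only if there exists a nonempty closed and connected subspace Z of Dom_F(D) such that R = A(Z), the intersection of the valuation rings in Z. -/
/-!
Common definitions: valuation rings of a field, the Zariski--Riemann space
`Zar_F(D)` with its Zariski and patch topologies, domination of local subrings,
residual algebraicity, integral closedness, and projective models of `F/D`.
-/

variable {F : Type*} [Field F]

/-- `x` lies in the maximal ideal (set of nonunits) of the (local) subring `R` of `F`. -/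
def MemMaxIdeal (R : Subring F) (x : F) : Prop :=
  ∃ h : x ∈ R, ¬ IsUnit (⟨x, h⟩ : R)

/-- The local ring `R` dominates the local ring `S` (both subrings of `F`):
`S ⊆ R` and the maximal ideal of `R` contracts to the maximal ideal of `S`. -/
def Dominates (R S : Subring F) : Prop :=
  S ≤ R ∧ ∀ x ∈ S, (MemMaxIdeal S x ↔ MemMaxIdeal R x)

/-- `V` is a valuation ring of the field `F`: for every nonzero `x ∈ F`,
`x ∈ V` or `x⁻¹ ∈ V`. -/
def IsValSubring (V : Subring F) : Prop :=
  ∀ x : F, x ≠ 0 → x ∈ V ∨ x⁻¹ ∈ V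

/-- `Zar_F(D)`: the valuation rings of `F` containing `D`. -/
def zarSet (D : Subring F) : Set (Subring F) :=
  {V | IsValSubring V ∧ D ≤ V}

/-- `Dom_F(D)`: the valuation rings of `F` dominating the local subring `D`. -/
def domSet (D : Subring F) : Set (Subring F) :=
  {V | IsValSubring V ∧ Dominates V D}

/-- The Zariski topology on a collection `X` of subrings of `F`, with basic open sets
`U(x₁,…,xₙ) = {R ∈ X : x₁,…,xₙ ∈ R}`. -/
def zariskiTop (X : Set (Subring F)) : TopologicalSpace X :=
  TopologicalSpace.generateFrom
    {U | ∃ s : Finset F, U = {R : X | ∀ x ∈ s, x ∈ (R : Subring F)}}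

/-- The patch topology on a collection `X` of subrings of `F`: generated by the
quasicompact Zariski-open sets together with their complements. -/
def patchTop (X : Set (Subring F)) : TopologicalSpace X :=
  TopologicalSpace.generateFrom
    ({U | @IsOpen _ (zariskiTop X) U ∧ @IsCompact _ (zariskiTop X) U} ∪
      {V | ∃ U, @IsOpen _ (zariskiTop X) U ∧ @IsCompact _ (zariskiTop X) U ∧ V = Uᶜ})

/-- `R` is residually algebraic over `D`: the residue field extension
`D/m_D → R/m_R` is algebraic, i.e. each element of `R` satisfies, modulo the
maximal ideal of `R`, a monic polynomial with coefficients in `D`. -/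
def ResiduallyAlgebraic (D R : Subring F) : Prop :=
  ∀ x ∈ R, ∃ p : Polynomial F, p.Monic ∧ (∀ i, p.coeff i ∈ D) ∧ MemMaxIdeal R (p.eval x)

/-- `R` is integrally closed in `F`: every element of `F` integral over `R` lies in `R`. -/
def IntegrallyClosedIn (R : Subring F) : Prop :=
  ∀ x : F, (∃ p : Polynomial F, p.Monic ∧ (∀ i, p.coeff i ∈ R) ∧ p.eval x = 0) → x ∈ R

/-- The localization of the subring `A` of `F` at the prime ideal `P`, viewed as the
subring of `F` generated by the fractions `a/b` with `a, b ∈ A`, `b ∉ P`. -/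
def localizationSubring (A : Subring F) (P : Ideal A) : Subring F :=
  Subring.closure {z : F | ∃ a b : A, b ∉ P ∧ z = (a : F) * (b : F)⁻¹}

/-- The ring `D[x₁/xᵢ, …, xₙ/xᵢ]`. -/
def modelChart (D : Subring F) {n : ℕ} (x : Fin n → F) (i : Fin n) : Subring F :=
  Subring.closure ((D : Set F) ∪ {y | ∃ j, y = x j * (x i)⁻¹})

/-- `X` is the projective model of `F/D` defined by some nonzero elements
`x₀, …, xₙ` of `F`: the set of all localizations of the rings
`D[x₀/xᵢ, …, xₙ/xᵢ]` at their prime ideals. -/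
def IsProjModel (D : Subring F) (X : Set (Subring F)) : Prop :=
  ∃ (n : ℕ) (x : Fin (n + 1) → F), (∀ i, x i ≠ 0) ∧
    X = {R | ∃ (i : Fin (n + 1)) (P : Ideal (modelChart D x i)),
          P.IsPrime ∧ R = localizationSubring (modelChart D x i) P}

/-- `X(Z)`: the members of the projective model `X` dominated by some valuation ring
in `Z`. -/
def modelImage (X Z : Set (Subring F)) : Set (Subring F) :=
  {α ∈ X | ∃ V ∈ Z, Dominates V α}

/-- `A(Y)`: the intersection of a collection `Y` of subrings of `F`, as a subset of `F`. -/
def ringsInter (Y : Set (Subring F)) : Set F :=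
  ⋂ R ∈ Y, (R : Set F)

/-- Idempotents modulo the radical of `J` lift to idempotents modulo every power of `J`. -/
lemma exists_idempotent_mod_pow {A : Type*} [CommRing A] (J : Ideal A) (b : A)
    (hb : b * (1 - b) ∈ J.radical) (N : ℕ) :
    ∃ e : A, e * (1 - e) ∈ J ^ N ∧ e - b ∈ J.radical := by
  rcases Nat.eq_zero_or_pos N with rfl | hN
  · exact ⟨b, by simp, by simp⟩
  have hle : J ^ N ≤ J.radical := (Ideal.pow_le_self hN.ne').trans Ideal.le_radical
  let f : A ⧸ J ^ N →+* A ⧸ J.radical := Ideal.Quotient.factor hle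
  have hker : ∀ x ∈ RingHom.ker f, IsNilpotent x := by
    intro x hx
    obtain ⟨a, rfl⟩ := Ideal.Quotient.mk_surjective x
    rw [RingHom.mem_ker, Ideal.Quotient.factor_mk, Ideal.Quotient.eq_zero_iff_mem] at hx
    obtain ⟨k, hk⟩ := hx
    refine ⟨k * N, ?_⟩
    rw [← map_pow, Ideal.Quotient.eq_zero_iff_mem, pow_mul]
    exact Ideal.pow_mem_pow hk N
  have hid : IsIdempotentElem (Ideal.Quotient.mk J.radical b) := by
    rw [IsIdempotentElem, ← map_mul, Ideal.Quotient.eq, ← neg_mem_iff]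
    convert hb using 1; ring
  obtain ⟨e', he', hfe⟩ := exists_isIdempotentElem_eq_of_ker_isNilpotent f hker _
    ⟨Ideal.Quotient.mk _ b, Ideal.Quotient.factor_mk hle b⟩ hid
  obtain ⟨e, rfl⟩ := Ideal.Quotient.mk_surjective e'
  refine ⟨e, ?_, ?_⟩
  · rw [IsIdempotentElem, ← map_mul, Ideal.Quotient.eq, ← neg_mem_iff] at he'
    convert he' using 1; ring
  · rwa [Ideal.Quotient.factor_mk, Ideal.Quotient.eq] at hfe

/-- Elements idempotent modulo `J ^ N` that agree modulo the radical of `J` agree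
modulo `J ^ N`. -/
lemma sub_mem_pow_of_idempotent {A : Type*} [CommRing A] (J : Ideal A) (N : ℕ) (e e' : A)
    (he : e * (1 - e) ∈ J ^ N) (he' : e' * (1 - e') ∈ J ^ N) (h : e - e' ∈ J.radical) :
    e - e' ∈ J ^ N := by
  have hid : ∀ e : A, e * (1 - e) ∈ J ^ N → IsIdempotentElem (Ideal.Quotient.mk (J ^ N) e) := by
    intro e he
    rw [IsIdempotentElem, ← map_mul, Ideal.Quotient.eq, ← neg_mem_iff]
    convert he using 1; ring
  rw [← Ideal.Quotient.eq]
  refine eq_of_isNilpotent_sub_of_isIdempotentElem (hid e he) (hid e' he') ?_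
  obtain ⟨k, hk⟩ := h
  refine ⟨k * N, ?_⟩
  rw [← map_sub, ← map_pow, Ideal.Quotient.eq_zero_iff_mem, pow_mul]
  exact Ideal.pow_mem_pow hk N

/-- Krull's intersection theorem in a quotient: if `δ` lies in `P + I ^ j • Q` for all `j` and
`Q` is finitely generated, then `δ` is in `P` up to a factor in `1 + I`. -/
lemma exists_sub_smul_mem_of_forall_pow {k M : Type*} [CommRing k] [IsNoetherianRing k]
    [AddCommGroup M] [Module k M] (I : Ideal k) (P Q : Submodule k M) (hQ : Q.FG) (δ : M)
    (h : ∀ j : ℕ, δ ∈ P ⊔ I ^ j • Q) : ∃ r ∈ I, δ - r • δ ∈ P := by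
  let Q' := Q.map P.mkQ
  have hfin : Module.Finite k Q' := Module.Finite.iff_fg.2 (hQ.map _)
  have hmem : ∀ j : ℕ, P.mkQ δ ∈ I ^ j • Q' := by
    intro j
    obtain ⟨p, hp, q, hq, rfl⟩ := Submodule.mem_sup.1 (h j)
    rw [map_add, show P.mkQ p = 0 by simpa using hp, zero_add, ← Submodule.map_smul'']
    exact Submodule.mem_map_of_mem hq
  have hδ : P.mkQ δ ∈ Q' := by simpa using hmem 0
  have key : (⟨P.mkQ δ, hδ⟩ : Q') ∈ (⨅ i : ℕ, I ^ i • ⊤ : Submodule k Q') := by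
    rw [Submodule.mem_iInf]
    intro j
    have := hmem j
    rw [← Submodule.map_subtype_top Q', ← Submodule.map_smul''] at this
    obtain ⟨y, hy, hyx⟩ := this
    rwa [show y = ⟨P.mkQ δ, hδ⟩ from Subtype.ext hyx] at hy
  obtain ⟨r, hr⟩ := (Ideal.mem_iInf_smul_pow_eq_bot_iff I _).1 key
  refine ⟨r, r.2, ?_⟩
  have := congrArg Subtype.val hr
  rw [← Submodule.Quotient.mk_eq_zero, Submodule.Quotient.mk_sub, sub_eq_zero]
  exact this.symm

lemma Subalgebra.mem_map_pow_iff {k F : Type*} [CommRing k] [CommRing F] [Algebra k F]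
    (I : Ideal k) (S : Subalgebra k F) (N : ℕ) (x : S) :
    x ∈ (I.map (algebraMap k S)) ^ N ↔ (x : F) ∈ I ^ N • Subalgebra.toSubmodule S := by
  have h : (I ^ N • (⊤ : Submodule k S)).map S.val.toLinearMap
      = I ^ N • Subalgebra.toSubmodule S := by
    rw [Submodule.map_smul'']
    congr 1
    ext y
    simp
  rw [← h, ← Ideal.map_pow, Ideal.smul_top_eq_map]
  constructor
  · exact fun hx => ⟨x, hx, rfl⟩
  · rintro ⟨y, hy, hyx⟩
    rwa [show y = x from Subtype.ext hyx] at hy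

/-- Two functions on the pieces `A0`, `A1` of a cover of "length one" with finitely generated first
cohomology, which are idempotent and agree modulo the radical of the extension of `I`, can be
replaced modulo that radical by a single global function. -/
lemma exists_glue {k F : Type*} [CommRing k] [IsNoetherianRing k] [CommRing F] [Algebra k F]
    (I : Ideal k) (A0 A1 B : Subalgebra k F) (h0 : A0 ≤ B) (h1 : A1 ≤ B)
    (L : Submodule k F) (hL : L.FG)
    (hcov : Subalgebra.toSubmodule B ≤ Subalgebra.toSubmodule A0 ⊔ Subalgebra.toSubmodule A1 ⊔ L)
    (b0 : A0) (b1 : A1)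
    (hb0 : b0 * (1 - b0) ∈ (I.map (algebraMap k A0)).radical)
    (hb1 : b1 * (1 - b1) ∈ (I.map (algebraMap k A1)).radical)
    (hb : Subalgebra.inclusion h0 b0 - Subalgebra.inclusion h1 b1
      ∈ (I.map (algebraMap k B)).radical) :
    ∃ (c0 : A0) (c1 : A1), (c0 : F) = c1 ∧ c0 - b0 ∈ (I.map (algebraMap k A0)).radical ∧
      c1 - b1 ∈ (I.map (algebraMap k A1)).radical := by
  have hmap : ∀ (S : Subalgebra k F) (hS : S ≤ B) (N : ℕ) (x : S),
      x ∈ (I.map (algebraMap k S)) ^ N →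
        Subalgebra.inclusion hS x ∈ (I.map (algebraMap k B)) ^ N := by
    intro S hS N x hx
    rw [Subalgebra.mem_map_pow_iff] at hx ⊢
    exact Submodule.smul_mono le_rfl hS hx
  have hrad : ∀ (S : Subalgebra k F) (hS : S ≤ B) (x : S),
      x ∈ (I.map (algebraMap k S)).radical →
        Subalgebra.inclusion hS x ∈ (I.map (algebraMap k B)).radical := by
    rintro S hS x ⟨n, hn⟩
    refine ⟨n, ?_⟩
    have := hmap S hS 1 _ (by rwa [pow_one])
    rwa [pow_one, map_pow] at this
  choose e0 he0 he0b using fun N => exists_idempotent_mod_pow _ b0 hb0 N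
  choose e1 he1 he1b using fun N => exists_idempotent_mod_pow _ b1 hb1 N
  have hd0 : ∀ N, e0 1 - e0 (N + 1) ∈ (I.map (algebraMap k A0)) ^ 1 := fun N =>
    sub_mem_pow_of_idempotent _ 1 _ _ (he0 1) (Ideal.pow_le_pow_right (by omega) (he0 (N + 1)))
      (by simpa using sub_mem (he0b 1) (he0b (N + 1)))
  have hd1 : ∀ N, e1 1 - e1 (N + 1) ∈ (I.map (algebraMap k A1)) ^ 1 := fun N =>
    sub_mem_pow_of_idempotent _ 1 _ _ (he1 1) (Ideal.pow_le_pow_right (by omega) (he1 (N + 1)))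
      (by simpa using sub_mem (he1b 1) (he1b (N + 1)))
  have hd01 : ∀ N, Subalgebra.inclusion h0 (e0 N) - Subalgebra.inclusion h1 (e1 N)
      ∈ (I.map (algebraMap k B)) ^ N := by
    intro N
    refine sub_mem_pow_of_idempotent _ N _ _ ?_ ?_ ?_
    · simpa using hmap A0 h0 N _ (he0 N)
    · simpa using hmap A1 h1 N _ (he1 N)
    · have := sub_mem (add_mem hb (hrad A0 h0 _ (he0b N))) (hrad A1 h1 _ (he1b N))
      convert this using 1
      simp only [map_sub]; ring
  let P := I • Subalgebra.toSubmodule A0 ⊔ I • Subalgebra.toSubmodule A1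
  have hmem : ∀ j : ℕ, ((e0 1 : F) - e1 1) ∈ P ⊔ I ^ j • (I • L) := by
    intro j
    have h2 : I ^ (j + 1) • Subalgebra.toSubmodule B ≤ P ⊔ I ^ j • (I • L) := by
      rw [pow_succ, ← smul_eq_mul, Submodule.smul_assoc]
      refine (Submodule.smul_mono le_rfl (Submodule.smul_mono le_rfl hcov)).trans ?_
      rw [Submodule.smul_sup, Submodule.smul_sup, Submodule.smul_sup]
      exact sup_le_sup_right Submodule.smul_le_right _
    have a0 := (Subalgebra.mem_map_pow_iff _ _ _ _).1 (hd0 j)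
    have a1 := (Subalgebra.mem_map_pow_iff _ _ _ _).1 (hd1 j)
    have a2 := h2 ((Subalgebra.mem_map_pow_iff _ _ _ _).1 (hd01 (j + 1)))
    rw [pow_one] at a0 a1
    have a0' : _ ∈ P ⊔ I ^ j • (I • L) := Submodule.mem_sup_left (Submodule.mem_sup_left a0)
    have a1' : _ ∈ P ⊔ I ^ j • (I • L) := Submodule.mem_sup_left (Submodule.mem_sup_right a1)
    convert sub_mem (add_mem a0' a2) a1' using 1
    simp
  obtain ⟨r, hr, hrP⟩ := exists_sub_smul_mem_of_forall_pow I P (I • L)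
    (Submodule.FG.smul (IsNoetherian.noetherian I) hL) _ hmem
  obtain ⟨p0, hp0, p1, hp1, hp⟩ := Submodule.mem_sup.1 hrP
  have hp0' : p0 ∈ A0 := Submodule.smul_le_right hp0
  have hp1' : p1 ∈ A1 := Submodule.smul_le_right hp1
  have aux : ∀ (S : Subalgebra k F) (e p : S), (p : F) ∈ I • Subalgebra.toSubmodule S →
      r • e + p ∈ (I.map (algebraMap k S)).radical := by
    intro S e p hp
    refine Ideal.le_radical ?_
    rw [← pow_one (I.map _), Subalgebra.mem_map_pow_iff, pow_one]
    exact add_mem (Submodule.smul_mem_smul hr e.2) hp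
  refine ⟨e0 1 - (r • e0 1 + ⟨p0, hp0'⟩), e1 1 - (r • e1 1 + ⟨-p1, neg_mem hp1'⟩), ?_, ?_, ?_⟩
  · push_cast
    rw [smul_sub] at hp
    linear_combination -hp
  · convert sub_mem (he0b 1) (aux A0 (e0 1) ⟨p0, hp0'⟩ hp0) using 1
    ring
  · convert sub_mem (he1b 1) (aux A1 (e1 1) ⟨-p1, neg_mem hp1'⟩ (neg_mem hp1)) using 1
    ring

lemma ValuationSubring.mul_mem_nonunits (V : ValuationSubring F) {x y : F} (hx : x ∈ V)
    (hy : y ∈ V.nonunits) : x * y ∈ V.nonunits := by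
  rw [ValuationSubring.mem_nonunits_iff, map_mul]
  exact (mul_le_of_le_one_left' ((V.valuation_le_one_iff x).2 hx)).trans_lt hy

lemma ValuationSubring.one_notMem_nonunits (V : ValuationSubring F) : (1 : F) ∉ V.nonunits := by
  rw [ValuationSubring.mem_nonunits_iff]; simp

lemma ValuationSubring.notMem_nonunits_of_inv_mem (V : ValuationSubring F) {x : F} (hx : x ≠ 0)
    (h : x⁻¹ ∈ V) : x ∉ V.nonunits := by
  rw [ValuationSubring.mem_nonunits_iff_or]; tauto

lemma ValuationSubring.mem_nonunits_of_pow_mem (V : ValuationSubring F) {x : F} {k : ℕ}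
    (h : x ^ k ∈ V.nonunits) : x ∈ V.nonunits := by
  rw [ValuationSubring.mem_nonunits_iff, map_pow] at h
  rw [ValuationSubring.mem_nonunits_iff]
  by_contra hc
  exact absurd h (not_lt.2 (one_le_pow₀ (not_lt.1 hc)))

/-- If `n` stays proper modulo the maximal ideal of the valuation ring `W`, there is a valuation
ring inside `W` which is centered above `n`. -/
lemma exists_valuationSubring_le {S : Type*} [CommRing S] (φ : S →+* F) (W : ValuationSubring F)
    (hφ : ∀ s, φ s ∈ W) (n : Ideal S) (hn : ∀ s ∈ n, 1 - φ s ∉ W.nonunits) :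
    ∃ V ≤ W, (∀ s, φ s ∈ V) ∧ ∀ s ∈ n, φ s ∈ V.nonunits := by
  let B : Subring F :=
    { carrier := {y | ∃ s, ∃ w ∈ W.nonunits, y = φ s + w}
      zero_mem' := ⟨0, 0, zero_mem _, by simp⟩
      one_mem' := ⟨1, 0, zero_mem _, by simp⟩
      add_mem' := by
        rintro _ _ ⟨s, w, hw, rfl⟩ ⟨t, v, hv, rfl⟩
        exact ⟨s + t, w + v, add_mem hw hv, by rw [map_add]; ring⟩
      neg_mem' := by
        rintro _ ⟨s, w, hw, rfl⟩
        exact ⟨-s, -w, neg_mem hw, by rw [map_neg]; ring⟩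
      mul_mem' := by
        rintro _ _ ⟨s, w, hw, rfl⟩ ⟨t, v, hv, rfl⟩
        exact ⟨s * t, φ s * v + φ t * w + w * v, add_mem (add_mem (W.mul_mem_nonunits (hφ s) hv)
          (W.mul_mem_nonunits (hφ t) hw)) (mul_mem hw hv), by rw [map_mul]; ring⟩ }
  let I : Ideal B :=
    { carrier := {y | ∃ s ∈ n, ∃ w ∈ W.nonunits, (y : F) = φ s + w}
      zero_mem' := ⟨0, zero_mem _, 0, zero_mem _, by simp⟩
      add_mem' := by
        rintro a b ⟨s, hs, w, hw, ha⟩ ⟨t, ht, v, hv, hb⟩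
        exact ⟨s + t, add_mem hs ht, w + v, add_mem hw hv, by
          rw [map_add, Subring.coe_add, ha, hb]; ring⟩
      smul_mem' := by
        rintro ⟨_, s, w, hw, rfl⟩ b ⟨t, ht, v, hv, hb⟩
        exact ⟨s * t, Ideal.mul_mem_left _ _ ht, φ s * v + φ t * w + w * v,
          add_mem (add_mem (W.mul_mem_nonunits (hφ s) hv)
          (W.mul_mem_nonunits (hφ t) hw)) (mul_mem hw hv), by
            rw [smul_eq_mul, Subring.coe_mul, hb, map_mul]; ring⟩ }
  have hI : I ≠ ⊤ := by
    rw [Ne, Ideal.eq_top_iff_one]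
    rintro ⟨s, hs, w, hw, h⟩
    refine hn s hs ?_
    rw [← Subring.coe_one B, h]
    simpa using hw
  obtain ⟨V, hV, hIV⟩ := Ideal.image_subset_nonunits_valuationSubring I hI
  refine ⟨V, ?_, fun s => hV ⟨s, 0, zero_mem _, by simp⟩, fun s hs => ?_⟩
  · rw [← ValuationSubring.nonunits_le_nonunits]
    intro w hw
    exact hIV ⟨⟨w, 0, w, hw, by simp⟩, ⟨0, zero_mem _, w, hw, by simp⟩, rfl⟩
  · exact hIV ⟨⟨φ s, s, 0, zero_mem _, by simp⟩, ⟨s, hs, 0, zero_mem _, by simp⟩, rfl⟩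

/-- A set of valuation rings is Zariski closed among those that contain `D`. -/
def ZarClosed (D : Subring F) (C : Set (ValuationSubring F)) : Prop :=
  ∀ V : ValuationSubring F, D ≤ V.toSubring →
    (∀ s : Finset F, (∀ x ∈ s, x ∈ V) → ∃ W ∈ C, ∀ x ∈ s, x ∈ W) → V ∈ C

lemma ZarClosed.mem_of_le {D : Subring F} {C : Set (ValuationSubring F)} (hC : ZarClosed D C)
    {V W : ValuationSubring F} (hD : D ≤ V.toSubring) (hVW : V ≤ W) (hW : W ∈ C) : V ∈ C :=
  hC V hD fun _ hs => ⟨W, hW, fun x hx => hVW (hs x hx)⟩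

/-- The limit of a family of valuation rings along an ultrafilter. -/
def ultraLimit {ι : Type*} (U : Ultrafilter ι) (V : ι → ValuationSubring F) :
    ValuationSubring F where
  carrier := {x | ∀ᶠ i in (U : Filter ι), x ∈ V i}
  zero_mem' := Filter.Eventually.of_forall fun i => zero_mem (V i)
  one_mem' := Filter.Eventually.of_forall fun i => one_mem (V i)
  add_mem' := fun ha hb => by filter_upwards [ha, hb] with i hi hj using add_mem hi hj
  mul_mem' := fun ha hb => by filter_upwards [ha, hb] with i hi hj using mul_mem hi hj
  neg_mem' := fun ha => by filter_upwards [ha] with i hi using neg_mem hi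
  mem_or_inv_mem' := fun x => Ultrafilter.eventually_or.1
    (Filter.Eventually.of_forall fun i => (V i).mem_or_inv_mem x)

lemma mem_ultraLimit {ι : Type*} {U : Ultrafilter ι} {V : ι → ValuationSubring F} {x : F} :
    x ∈ ultraLimit U V ↔ ∀ᶠ i in (U : Filter ι), x ∈ V i := Iff.rfl

lemma ZarClosed.ultraLimit_mem {D : Subring F} {C : Set (ValuationSubring F)}
    (hC : ZarClosed D C) (hD : ∀ V ∈ C, D ≤ V.toSubring) {ι : Type*} (U : Ultrafilter ι)
    (V : ι → ValuationSubring F) (hV : ∀ i, V i ∈ C) : ultraLimit U V ∈ C := by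
  refine hC _ (fun x hx => Filter.Eventually.of_forall fun i => hD _ (hV i) hx) fun s hs => ?_
  have : ∀ᶠ i in (U : Filter ι), ∀ x ∈ s, x ∈ V i :=
    (Filter.eventually_all_finset s).2 hs
  obtain ⟨i, hi⟩ := this.exists
  exact ⟨V i, hV i, hi⟩

lemma exists_ultrafilter_dvd (M : Type*) [CommMonoid M] :
    ∃ U : Ultrafilter M, ∀ s : M, ∀ᶠ t in (U : Filter M), s ∣ t := by
  have : (⨅ s : M, Filter.principal {t | s ∣ t}).NeBot := by
    refine Filter.iInf_neBot_of_directed' ?_ fun s => Filter.principal_neBot_iff.2 ⟨s, dvd_rfl⟩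
    intro a b
    refine ⟨a * b, ?_, ?_⟩ <;> simp only [ge_iff_le, Filter.le_principal_iff,
      Filter.mem_principal, Set.ofPred_subset_ofPred]
    · exact fun t ht => (Dvd.intro _ rfl).trans ht
    · exact fun t ht => (Dvd.intro_left _ rfl).trans ht
  refine ⟨Ultrafilter.of (⨅ s : M, Filter.principal {t | s ∣ t}), fun s => ?_⟩
  exact Ultrafilter.of_le _ (Filter.mem_iInf_of_mem s (Filter.mem_principal_self _))

/-- Disjoint closed sets of valuation rings are separated by membership of finitely many
elements. -/
lemma ZarClosed.exists_finset_separating {D : Subring F} {C1 C2 : Set (ValuationSubring F)}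
    (h1 : ZarClosed D C1) (h2 : ZarClosed D C2) (hD1 : ∀ V ∈ C1, D ≤ V.toSubring)
    (hD2 : ∀ V ∈ C2, D ≤ V.toSubring) (hdisj : Disjoint C1 C2) :
    ∃ E : Finset F, ∀ V ∈ C1, ∀ W ∈ C2, ∃ x ∈ E, ¬ (x ∈ V ↔ x ∈ W) := by
  by_contra! h
  choose V hV W hW hVW using h
  let U : Ultrafilter (Finset F) := Ultrafilter.of Filter.atTop
  have heq : ultraLimit U V = ultraLimit U W := by
    ext x
    rw [mem_ultraLimit, mem_ultraLimit]
    refine Filter.eventually_congr ?_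
    have : ∀ᶠ E in (U : Filter (Finset F)), {x} ≤ E :=
      Ultrafilter.of_le _ (Filter.eventually_ge_atTop _)
    filter_upwards [this] with E hE
    exact hVW E x (hE (Finset.mem_singleton_self x))
  exact Set.disjoint_left.1 hdisj (h1.ultraLimit_mem hD1 U V hV)
    (heq ▸ h2.ultraLimit_mem hD2 U W hW)

/-- A prime of `B` containing the intersection of the centers of a set of members of a closed
set `C` is contained in the center of a member of `C`. -/
lemma ZarClosed.exists_mem_centered {D : Subring F} {C : Set (ValuationSubring F)}
    (hC : ZarClosed D C) (hD : ∀ V ∈ C, D ≤ V.toSubring) (B : Subring F) (hDB : D ≤ B)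
    (n : Ideal B) [n.IsPrime]
    (hn : ∀ b : B, (∀ V ∈ C, B ≤ V.toSubring → (b : F) ∈ V.nonunits) → b ∈ n) :
    ∃ V ∈ C, B ≤ V.toSubring ∧ ∀ b ∈ n, (b : F) ∈ V.nonunits := by
  have h : ∀ s : n.primeCompl, ∃ V ∈ C, B ≤ V.toSubring ∧ ((s : B) : F) ∉ V.nonunits := by
    intro s
    by_contra! hc
    exact s.2 (hn s hc)
  choose V hVC hBV hVs using h
  obtain ⟨U, hU⟩ := exists_ultrafilter_dvd n.primeCompl
  have hWC := hC.ultraLimit_mem hD U V hVC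
  have hBW : B ≤ (ultraLimit U V).toSubring :=
    fun x hx => Filter.Eventually.of_forall fun i => hBV i hx
  have hcenter : ∀ b : B, (b : F) ∈ (ultraLimit U V).nonunits → b ∈ n := by
    intro b hb
    by_contra hbn
    have hb0 : (b : F) ≠ 0 := by
      rintro h0
      exact hbn (by rw [show b = 0 from Subtype.ext h0]; exact zero_mem n)
    refine ValuationSubring.notMem_nonunits_of_inv_mem _ hb0 ?_ hb
    rw [mem_ultraLimit]
    filter_upwards [hU ⟨b, hbn⟩] with t ht
    obtain ⟨r, rfl⟩ := ht
    by_contra hbt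
    refine hVs (⟨b, hbn⟩ * r) ?_
    have : (b : F) ∈ (V (⟨b, hbn⟩ * r)).nonunits := by
      rw [ValuationSubring.mem_nonunits_iff_or]; exact Or.inr hbt
    rw [Submonoid.coe_mul, Subring.coe_mul, mul_comm (_ : F) (_ : F)]
    exact ValuationSubring.mul_mem_nonunits _ (hBV _ (SetLike.coe_mem (r : B))) this
  obtain ⟨W, hW, hWB, hWn⟩ := exists_valuationSubring_le B.subtype (ultraLimit U V)
    (fun s => hBW s.2) n (fun s hs h1 => by
      have h2 : 1 - s ∈ n := hcenter (1 - s) (by simpa using h1)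
      exact Ideal.IsPrime.ne_top ‹_› ((Ideal.eq_top_iff_one n).2 (by simpa using add_mem h2 hs)))
  exact ⟨W, hC.mem_of_le (fun x hx => hWB ⟨x, hDB hx⟩) hW hWC, fun x hx => hWB ⟨x, hx⟩, hWn⟩

open Polynomial in
lemma Subring.isIntegral_iff_exists_poly {B : Subring F} {x : F} :
    IsIntegral B x ↔ ∃ p : F[X], p.Monic ∧ (∀ i, p.coeff i ∈ B) ∧ p.eval x = 0 := by
  constructor
  · rintro ⟨p, hp, hpx⟩
    refine ⟨p.map B.subtype, hp.map _, fun i => ?_, ?_⟩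
    · rw [coeff_map]; exact (p.coeff i).2
    · rw [eval_map]; exact hpx
  · rintro ⟨p, hp, hc, hpx⟩
    have hc' : (p.coeffs : Set F) ⊆ B := by
      intro y hy
      obtain ⟨i, -, rfl⟩ := mem_coeffs_iff.1 hy
      exact hc i
    refine ⟨p.toSubring B hc', (monic_toSubring _ _ _).2 hp, ?_⟩
    rw [← hpx, ← eval_map]
    congr 1
    ext i
    rw [coeff_map]
    exact (coeff_toSubring p B hc').symm ▸ rfl

lemma Subring.isIntegral_mono {A B : Subring F} (h : A ≤ B) {x : F} (hx : IsIntegral A x) :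
    IsIntegral B x := by
  rw [Subring.isIntegral_iff_exists_poly] at hx ⊢
  obtain ⟨p, hp, hc, hpx⟩ := hx
  exact ⟨p, hp, fun i => h (hc i), hpx⟩

lemma ValuationSubring.mem_of_isIntegral (V : ValuationSubring F) {B : Subring F}
    (h : B ≤ V.toSubring) {x : F} (hx : IsIntegral B x) : x ∈ V := by
  have hx' : IsIntegral V x := Subring.isIntegral_mono h hx
  obtain ⟨y, rfl⟩ := IsIntegrallyClosed.isIntegral_iff.1 hx'
  exact y.2

/-- The subring generated by `A` and `x`. -/
abbrev Subring.adjoinElem (A : Subring F) (x : F) : Subring F :=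
  Subring.closure (insert x (A : Set F))

/-- The elements of `F` that are carried into `B` by a power of `x ∈ B`. -/
def Subring.away (B : Subring F) (x : F) (hx : x ∈ B) : Subring F where
  carrier := {y | ∃ r : ℕ, x ^ r * y ∈ B}
  zero_mem' := ⟨0, by simp⟩
  one_mem' := ⟨0, by simp⟩
  add_mem' := by
    rintro a b ⟨r, hr⟩ ⟨t, ht⟩
    refine ⟨r + t, ?_⟩
    convert add_mem (mul_mem (pow_mem hx t) hr) (mul_mem (pow_mem hx r) ht) using 1
    ring
  neg_mem' := by
    rintro a ⟨r, hr⟩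
    exact ⟨r, by simpa using hr⟩
  mul_mem' := by
    rintro a b ⟨r, hr⟩ ⟨t, ht⟩
    refine ⟨r + t, ?_⟩
    convert mul_mem hr ht using 1
    ring

lemma Subring.le_away (B : Subring F) (x : F) (hx : x ∈ B) : B ≤ B.away x hx :=
  fun y hy => ⟨0, by simpa using hy⟩

lemma Subring.inv_mem_away (B : Subring F) (x : F) (hx : x ∈ B) : x⁻¹ ∈ B.away x hx := by
  refine ⟨1, ?_⟩
  rcases eq_or_ne x 0 with rfl | h
  · simp
  · simp [h]

lemma Subring.exists_pow_mul_mem_of_away (B : Subring F) (x : F) (hx : x ∈ B) (S : Finset F)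
    (hS : ∀ y ∈ S, y ∈ B.away x hx) : ∃ r : ℕ, ∀ y ∈ S, x ^ r * y ∈ B := by
  have h : ∀ y : S, ∃ r : ℕ, x ^ r * y ∈ B := fun y => hS y y.2
  choose r hr using h
  refine ⟨S.attach.sup r, fun y hy => ?_⟩
  have hle : r ⟨y, hy⟩ ≤ S.attach.sup r := Finset.le_sup (Finset.mem_attach _ _)
  rw [← Nat.sub_add_cancel hle, pow_add, mul_assoc]
  exact mul_mem (pow_mem hx _) (hr ⟨y, hy⟩)

lemma Subring.adjoinElem_inv_le_away (A : Subring F) (x : F)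
    (hx : x ∈ A.adjoinElem x) : A.adjoinElem x⁻¹ ≤ (A.adjoinElem x).away x hx := by
  rw [Subring.closure_le]
  rintro y (rfl | hy)
  · exact Subring.inv_mem_away _ _ _
  · exact Subring.le_away _ _ _ (Subring.subset_closure (Or.inr hy))

lemma Subring.self_mem_adjoinElem (A : Subring F) (x : F) : x ∈ A.adjoinElem x :=
  Subring.subset_closure (Or.inl rfl)

lemma Subring.le_adjoinElem (A : Subring F) (x : F) : A ≤ A.adjoinElem x :=
  fun _ hy => Subring.subset_closure (Or.inr hy)

open Polynomial in
/-- Denominators clear: an element integral over the localization of `B` at `x` becomes integral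
over `B` after multiplication by a power of `x`. -/
lemma Subring.exists_isIntegral_pow_mul (B : Subring F) (x : F) (hx : x ∈ B) {c : F}
    (hc : IsIntegral (B.away x hx) c) : ∃ r : ℕ, IsIntegral B (x ^ r * c) := by
  rw [Subring.isIntegral_iff_exists_poly] at hc
  obtain ⟨p, hp, hpc, hpe⟩ := hc
  obtain ⟨r, hr⟩ := B.exists_pow_mul_mem_of_away x hx p.coeffs (by
    intro y hy
    obtain ⟨i, -, rfl⟩ := mem_coeffs_iff.1 hy
    exact hpc i)
  have hr' : ∀ i, x ^ r * p.coeff i ∈ B := by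
    intro i
    by_cases h : p.coeff i = 0
    · simp [h]
    · exact hr _ (coeff_mem_coeffs h)
  refine ⟨r, Subring.isIntegral_iff_exists_poly.2 ⟨p.scaleRoots (x ^ r),
    (monic_scaleRoots_iff _).2 hp, fun i => ?_, ?_⟩⟩
  · rw [coeff_scaleRoots]
    rcases lt_trichotomy i p.natDegree with h | h | h
    · obtain ⟨m, hm⟩ : ∃ m, p.natDegree - i = m + 1 := ⟨p.natDegree - i - 1, by omega⟩
      rw [hm, pow_succ]
      convert mul_mem (pow_mem (pow_mem hx r) m) (hr' i) using 1
      ring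
    · subst h
      simp [hp.coeff_natDegree]
    · simp [coeff_eq_zero_of_natDegree_lt h]
  · simpa [eval₂_id] using scaleRoots_eval₂_eq_zero (RingHom.id F) (s := x ^ r) (r := c)
      (by simpa [eval₂_id] using hpe)

lemma Subring.exists_finset_mem_closure (A : Subring F) (x : F) {y : F}
    (hy : y ∈ A.adjoinElem x) :
    ∃ s : Finset F, (s : Set F) ⊆ A ∧ y ∈ Subring.closure (insert x (s : Set F)) := by
  classical
  have mono : ∀ {s t : Finset F} {z : F}, s ⊆ t →
      z ∈ Subring.closure (insert x (s : Set F)) → z ∈ Subring.closure (insert x (t : Set F)) :=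
    fun h hz => Subring.closure_mono (Set.insert_subset_insert (by exact_mod_cast h)) hz
  induction hy using Subring.closure_induction with
  | mem y hy =>
    rcases hy with rfl | hy
    · exact ⟨∅, by simp, Subring.subset_closure (Or.inl rfl)⟩
    · exact ⟨{y}, by simpa using hy, Subring.subset_closure (Or.inr (by simp))⟩
  | zero => exact ⟨∅, by simp, zero_mem _⟩
  | one => exact ⟨∅, by simp, one_mem _⟩
  | add a b _ _ ha hb =>
    obtain ⟨s, hs, has⟩ := ha
    obtain ⟨t, ht, hbt⟩ := hb
    exact ⟨s ∪ t, by simp [hs, ht], add_mem (mono Finset.subset_union_left has)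
      (mono Finset.subset_union_right hbt)⟩
  | neg a _ ha =>
    obtain ⟨s, hs, has⟩ := ha
    exact ⟨s, hs, neg_mem has⟩
  | mul a b _ _ ha hb =>
    obtain ⟨s, hs, has⟩ := ha
    obtain ⟨t, ht, hbt⟩ := hb
    exact ⟨s ∪ t, by simp [hs, ht], mul_mem (mono Finset.subset_union_left has)
      (mono Finset.subset_union_right hbt)⟩

open Polynomial in
/-- Finitely many integral equations over `A[x]` only involve finitely many elements of `A`. -/
lemma Subring.exists_finset_isIntegral (A : Subring F) (x : F) (T : Finset F)
    (hT : ∀ t ∈ T, IsIntegral (A.adjoinElem x) t) :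
    ∃ s : Finset F, (s : Set F) ⊆ A ∧
      ∀ t ∈ T, IsIntegral (Subring.closure (insert x (s : Set F))) t := by
  classical
  have h1 : ∀ S : Finset F, (∀ y ∈ S, y ∈ A.adjoinElem x) → ∃ s : Finset F, (s : Set F) ⊆ A ∧
      ∀ y ∈ S, y ∈ Subring.closure (insert x (s : Set F)) := by
    intro S hS
    have : ∀ y : S, _ := fun y => A.exists_finset_mem_closure x (hS y y.2)
    choose s hsA hs using this
    refine ⟨S.attach.biUnion s, ?_, fun y hy => ?_⟩
    · intro z hz
      simp only [Finset.coe_biUnion, Set.mem_iUnion] at hz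
      obtain ⟨i, -, hi⟩ := hz
      exact hsA i hi
    · refine Subring.closure_mono (Set.insert_subset_insert ?_) (hs ⟨y, hy⟩)
      exact_mod_cast Finset.subset_biUnion_of_mem s (Finset.mem_attach S ⟨y, hy⟩)
  have h2 : ∀ t : T, ∃ p : F[X], p.Monic ∧ (∀ i, p.coeff i ∈ A.adjoinElem x) ∧ p.eval (t : F) = 0 :=
    fun t => Subring.isIntegral_iff_exists_poly.1 (hT t t.2)
  choose p hp hpc hpe using h2
  obtain ⟨s, hsA, hs⟩ := h1 (T.attach.biUnion fun t => (p t).coeffs) (by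
    intro y hy
    obtain ⟨t, -, ht⟩ := Finset.mem_biUnion.1 hy
    obtain ⟨i, -, rfl⟩ := mem_coeffs_iff.1 ht
    exact hpc t i)
  refine ⟨s, hsA, fun t ht => Subring.isIntegral_iff_exists_poly.2
    ⟨p ⟨t, ht⟩, hp _, fun i => ?_, hpe ⟨t, ht⟩⟩⟩
  by_cases h : (p ⟨t, ht⟩).coeff i = 0
  · rw [h]; exact zero_mem _
  · exact hs _ (Finset.mem_biUnion.2 ⟨⟨t, ht⟩, Finset.mem_attach _ _, coeff_mem_coeffs h⟩)

open Polynomial in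
/-- The valuative description of the radical of the extension of an ideal `n` of `A` to `B`. -/
lemma Subring.exists_pow_eq_sum_of_forall_nonunits {A B : Subring F} (hAB : A ≤ B) (n : Ideal A)
    {b : F} (hb : b ∈ B)
    (h : ∀ V : ValuationSubring F, B ≤ V.toSubring → (∀ a ∈ n, (a : F) ∈ V.nonunits) →
      b ∈ V.nonunits) :
    ∃ (k : ℕ) (l : List (A × B)), (∀ p ∈ l, p.1 ∈ n) ∧
      b ^ k = (l.map fun p => (p.1 : F) * p.2).sum := by
  rcases eq_or_ne b 0 with rfl | hb0
  · exact ⟨1, [], by simp, by simp⟩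
  let N : Ideal B := n.map (Subring.inclusion hAB)
  have hN : ∀ z ∈ N, ∃ l : List (A × B), (∀ p ∈ l, p.1 ∈ n) ∧
      (z : F) = (l.map fun p => (p.1 : F) * p.2).sum := by
    intro z hz
    refine Submodule.span_induction (p := fun (z : B) _ => ∃ l : List (A × B), (∀ p ∈ l, p.1 ∈ n) ∧
      (z : F) = (l.map fun p => (p.1 : F) * p.2).sum) ?_ ?_ ?_ ?_ hz
    · rintro _ ⟨a, ha, rfl⟩
      exact ⟨[(a, 1)], by simpa using ha, by simp⟩
    · exact ⟨[], by simp, by simp⟩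
    · rintro y z _ _ ⟨l, hl, hy⟩ ⟨m, hm, hz⟩
      refine ⟨l ++ m, ?_, by simp [hy, hz]⟩
      intro p hp
      rcases List.mem_append.1 hp with hp | hp
      exacts [hl p hp, hm p hp]
    · rintro c z _ ⟨l, hl, hz⟩
      refine ⟨l.map fun p => (p.1, c * p.2), ?_, ?_⟩
      · intro p hp
        obtain ⟨q, hq, rfl⟩ := List.mem_map.1 hp
        exact hl q hq
      · rw [smul_eq_mul, Subring.coe_mul, hz, List.map_map, ← List.sum_map_mul_left]
        congr 2
        ext p
        simp only [Function.comp, Subring.coe_mul]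
        ring
  by_contra hcon
  let φ : B[X] →+* F := eval₂RingHom B.subtype b⁻¹
  obtain ⟨V, -, hV, hVN⟩ := exists_valuationSubring_le φ ⊤ (fun _ => trivial) (N.map C) (by
    intro q hq h1
    rw [ValuationSubring.mem_nonunits_iff_or] at h1
    have h2 : φ q = 1 := by
      rcases h1 with h1 | h1
      · rw [sub_eq_zero] at h1; exact h1.symm
      · exact absurd trivial h1
    rw [Ideal.mem_map_C_iff] at hq
    have h3 : b ^ q.natDegree = ((∑ i ∈ Finset.range (q.natDegree + 1),
        ⟨b, hb⟩ ^ (q.natDegree - i) * q.coeff i : B) : F) := by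
      rw [← mul_one (b ^ q.natDegree), ← h2]
      simp only [φ, coe_eval₂RingHom, eval₂_eq_sum_range, Finset.mul_sum]
      push_cast
      refine Finset.sum_congr rfl fun i hi => ?_
      have hi' : i ≤ q.natDegree := by simpa [Nat.lt_succ_iff] using hi
      rw [← Nat.sub_add_cancel hi', pow_add, Nat.sub_add_cancel hi']
      simp only [inv_pow, Subring.subtype_apply]
      field_simp
    obtain ⟨l, hl, hls⟩ := hN _ (sum_mem fun i _ => Ideal.mul_mem_left _ _ (hq i))
    exact hcon ⟨q.natDegree, l, hl, h3.trans hls⟩)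
  have hBV : B ≤ V.toSubring := fun y hy => by simpa [φ] using hV (C ⟨y, hy⟩)
  refine V.notMem_nonunits_of_inv_mem hb0 (by simpa [φ] using hV X) (h V hBV fun a ha => ?_)
  simpa [φ] using hVN (C (Subring.inclusion hAB a))
    (Ideal.mem_map_of_mem _ (Ideal.mem_map_of_mem _ ha))

/-- The integral closure in `F` of the ring generated by `A` and `x`. -/
def Subring.chart (A : Subring F) (x : F) : Subring F :=
  (integralClosure (A.adjoinElem x) F).toSubring

lemma Subring.mem_chart {A : Subring F} {x y : F} :
    y ∈ A.chart x ↔ IsIntegral (A.adjoinElem x) y := Iff.rfl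

lemma Subring.adjoinElem_le_chart (A : Subring F) (x : F) : A.adjoinElem x ≤ A.chart x :=
  fun y hy => Subring.mem_chart.2 (isIntegral_algebraMap (x := (⟨y, hy⟩ : A.adjoinElem x)))

lemma Subring.le_chart (A : Subring F) (x : F) : A ≤ A.chart x :=
  (A.le_adjoinElem x).trans (A.adjoinElem_le_chart x)

lemma Subring.self_mem_chart (A : Subring F) (x : F) : x ∈ A.chart x :=
  A.adjoinElem_le_chart x (A.self_mem_adjoinElem x)

lemma Subring.chart_le {A : Subring F} {x : F} {V : ValuationSubring F} (hA : A ≤ V.toSubring)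
    (hx : x ∈ V) : A.chart x ≤ V.toSubring := by
  intro y hy
  refine V.mem_of_isIntegral (B := A.adjoinElem x) ?_ hy
  rw [Subring.closure_le]
  rintro z (rfl | hz)
  exacts [hx, hA hz]

lemma Subring.mem_chart_of_isIntegral {A : Subring F} {x y : F} (hy : IsIntegral (A.chart x) y) :
    y ∈ A.chart x :=
  isIntegral_trans (R := A.adjoinElem x) (A := integralClosure (A.adjoinElem x) F) y hy

lemma Subring.chart_inv_le_away {A : Subring F} {x : F} :
    A.chart x⁻¹ ≤ (A.chart x).away x (A.self_mem_chart x) := by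
  intro y hy
  obtain ⟨r, hr⟩ := Subring.exists_isIntegral_pow_mul (A.adjoinElem x) x (A.self_mem_adjoinElem x)
    (Subring.isIntegral_mono (A.adjoinElem_inv_le_away x (A.self_mem_adjoinElem x)) hy)
  exact ⟨r, hr⟩

lemma Subring.exists_valuationSubring_notMem {A : Subring F} (hA : ∀ y : F, IsIntegral A y → y ∈ A)
    {y : F} (hy : y ∉ A) : ∃ V : ValuationSubring F, A ≤ V.toSubring ∧ y ∉ V := by
  have : IsIntegrallyClosedIn A F := Subring.isIntegrallyClosedIn_iff.2 fun {z} hz => hA z hz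
  exact Subring.exists_le_valuationSubring_of_isIntegrallyClosedIn hy

lemma Subring.mem_of_mem_chart {A : Subring F} (hA : ∀ y : F, IsIntegral A y → y ∈ A) {x y : F}
    (h0 : y ∈ A.chart x) (h1 : y ∈ A.chart x⁻¹) : y ∈ A := by
  by_contra hy
  obtain ⟨V, hV, hyV⟩ := A.exists_valuationSubring_notMem hA hy
  rcases V.mem_or_inv_mem x with h | h
  · exact hyV (Subring.chart_le hV h h0)
  · exact hyV (Subring.chart_le hV h h1)

lemma Subalgebra.coe_mem_nonunits_of_mem_radical {k : Subring F} (I : Ideal k)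
    (S : Subalgebra k F) (V : ValuationSubring F) (hS : ∀ y ∈ S, y ∈ V)
    (hI : ∀ a ∈ I, (a : F) ∈ V.nonunits) {z : S}
    (hz : z ∈ (I.map (algebraMap k S)).radical) : (z : F) ∈ V.nonunits := by
  obtain ⟨m, hm⟩ := hz
  refine V.mem_nonunits_of_pow_mem (k := m) ?_
  rw [← pow_one (I.map _), Subalgebra.mem_map_pow_iff, pow_one] at hm
  refine Submodule.smul_induction_on (p := fun y => y ∈ V.nonunits) hm (fun a ha y hy => ?_)
    fun _ _ => add_mem
  rw [Subring.smul_def, smul_eq_mul, mul_comm]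
  exact V.mul_mem_nonunits (hS y hy) (hI a ha)

lemma Subalgebra.mem_radical_of_pow_eq_sum {k A B : Subring F} (I : Ideal k)
    (S : Subalgebra k F) (l : List (A × B)) (hI : ∀ p ∈ l, ∃ a ∈ I, (a : F) = p.1)
    (hS : ∀ p ∈ l, (p.2 : F) ∈ S) {b : S} {m : ℕ}
    (hb : (b : F) ^ m = (l.map fun p => (p.1 : F) * p.2).sum) :
    b ∈ (I.map (algebraMap k S)).radical := by
  refine ⟨m, ?_⟩
  rw [← pow_one (I.map _), Subalgebra.mem_map_pow_iff, pow_one, SubmonoidClass.coe_pow, hb]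
  refine list_sum_mem fun y hy => ?_
  obtain ⟨p, hp, rfl⟩ := List.mem_map.1 hy
  obtain ⟨a, ha, hap⟩ := hI p hp
  rw [← hap, ← smul_eq_mul, ← Subring.smul_def]
  exact Submodule.smul_mem_smul ha (hS p hp)

/-- The Čech cover of the projective line: the cokernel of `A0 ⊕ A1 → B` is finitely generated. -/
lemma Subalgebra.le_sup_sup_span {k : Type*} [CommRing k] [Algebra k F] {x : F} (hx : x ≠ 0)
    (G : Set F) (A0 A1 B : Subalgebra k F) (hxA : x ∈ A0) (hGA : G ⊆ A0)
    (hA0 : ∀ a ∈ A0, a ∈ Submodule.span (Algebra.adjoin k {x}) G)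
    (hB : ∀ b ∈ B, ∃ N : ℕ, x ^ N * b ∈ A0) (r : ℕ)
    (hr : ∀ m ≥ r, ∀ g ∈ G, x⁻¹ ^ m * g ∈ A1) :
    Subalgebra.toSubmodule B ≤ Subalgebra.toSubmodule A0 ⊔ Subalgebra.toSubmodule A1 ⊔
      Submodule.span k (Set.image2 (fun m g => x⁻¹ ^ m * g) (Set.Iio r) G) := by
  set Y := Subalgebra.toSubmodule A0 ⊔ Subalgebra.toSubmodule A1 ⊔
      Submodule.span k (Set.image2 (fun m g => x⁻¹ ^ m * g) (Set.Iio r) G)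
  let P : Submodule k F :=
    { carrier := {z | ∀ N m : ℕ, x⁻¹ ^ N * x ^ m * z ∈ Y}
      zero_mem' := fun N m => by rw [mul_zero]; exact zero_mem Y
      add_mem' := fun {a b} ha hb N m => by rw [mul_add]; exact add_mem (ha N m) (hb N m)
      smul_mem' := fun c a ha N m => by rw [mul_smul_comm]; exact Y.smul_mem c (ha N m) }
  have hP : ∀ c ∈ Algebra.adjoin k {x}, ∀ z ∈ P, c * z ∈ P := by
    intro c hc
    induction hc using Algebra.adjoin_induction with
    | mem y hy =>
      obtain rfl := Set.mem_singleton_iff.1 hy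
      intro z hz N m
      rw [← mul_assoc, mul_assoc _ (y ^ m) y, ← pow_succ]
      exact hz N (m + 1)
    | algebraMap t =>
      intro z hz
      rw [← Algebra.smul_def]
      exact P.smul_mem t hz
    | add a b _ _ ha hb =>
      intro z hz
      rw [add_mul]
      exact add_mem (ha z hz) (hb z hz)
    | mul a b _ _ ha hb =>
      intro z hz
      rw [mul_assoc]
      exact ha _ (hb z hz)
  have hGP : ∀ g ∈ G, g ∈ P := by
    intro g hg N m
    rcases le_total N m with h | h
    · have : x⁻¹ ^ N * x ^ m * g = x ^ (m - N) * g := by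
        rw [pow_sub₀ x hx h, inv_pow]
        ring
      rw [this]
      exact Submodule.mem_sup_left (Submodule.mem_sup_left (A0.mul_mem (A0.pow_mem hxA _) (hGA hg)))
    · have : x⁻¹ ^ N * x ^ m * g = x⁻¹ ^ (N - m) * g := by
        rw [pow_sub₀ x⁻¹ (inv_ne_zero hx) h, inv_pow x m, inv_inv]
      rw [this]
      rcases le_or_gt r (N - m) with h' | h'
      · exact Submodule.mem_sup_left (Submodule.mem_sup_right (hr _ h' g hg))
      · exact Submodule.mem_sup_right (Submodule.subset_span ⟨_, h', g, hg, rfl⟩)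
  have hAP : ∀ a ∈ A0, a ∈ P := by
    intro a ha
    refine Submodule.span_induction (fun g hg => hGP g hg) (zero_mem P)
      (fun a b _ _ ha hb => add_mem ha hb) (fun c a _ ha => ?_) (hA0 a ha)
    rw [Algebra.smul_def]
    exact hP _ c.2 a ha
  intro b hb
  obtain ⟨N, hN⟩ := hB b hb
  have := hAP _ hN N 0
  rwa [pow_zero, mul_one, ← mul_assoc, ← mul_pow, inv_mul_cancel₀ hx, one_pow, one_mul] at this

/-- A subring containing `k`, as a `k`-algebra. -/
def Subring.subalgebraOfLE {k S : Subring F} (h : k ≤ S) : Subalgebra k F where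
  __ := S.toSubsemiring
  algebraMap_mem' r := h r.2

/-- A Čech cover of the projective line over a subring `k` of `A`: finitely many elements `T0` of
the first chart and `T1` of the overlap are realised over `k` in such a way that the cokernel is
finitely generated. -/
lemma Subring.exists_cover {A k : Subring F} (hkA : k ≤ A) {x : F} (hx : x ≠ 0) (T0 T1 : Finset F)
    (r : ℕ) (hT0 : ∀ t ∈ T0, IsIntegral (Algebra.adjoin k {x}) t)
    (hT1 : ∀ t ∈ T1, IsIntegral (Algebra.adjoin k {x}) (x ^ r * t)) :
    ∃ A0 A1 B : Subalgebra k F, A0 ≤ B ∧ (∀ y, y ∈ A1 ↔ y ∈ B ∧ y ∈ A.chart x⁻¹) ∧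
      (∀ y ∈ A0, y ∈ A.chart x) ∧ (∀ t ∈ T0, t ∈ A0) ∧ (∀ t ∈ T1, t ∈ B) ∧
      ∃ L : Submodule k F, L.FG ∧
        Subalgebra.toSubmodule B ≤ Subalgebra.toSubmodule A0 ⊔ Subalgebra.toSubmodule A1 ⊔ L := by
  classical
  let K : Subalgebra k F := Algebra.adjoin k {x}
  let T : Finset F := T0 ∪ T1.image (x ^ r * ·)
  have hTK : ∀ t ∈ (T : Set F), IsIntegral K t := by
    intro t ht
    simp only [T, Finset.coe_union, Set.mem_union, Finset.mem_coe, Finset.mem_image] at ht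
    rcases ht with ht | ⟨t, ht, rfl⟩
    exacts [hT0 t ht, hT1 t ht]
  have hKR : K.toSubring ≤ A.adjoinElem x := by
    have : K ≤ Subring.subalgebraOfLE (hkA.trans (A.le_adjoinElem x)) :=
      Algebra.adjoin_le (Set.singleton_subset_iff.2 (A.self_mem_adjoinElem x))
    exact this
  have hTR : ∀ t ∈ (T : Set F), t ∈ A.chart x := fun t ht =>
    Subring.mem_chart.2 (Subring.isIntegral_mono hKR (hTK t ht))
  obtain ⟨G, hG⟩ := fg_adjoin_of_finite T.finite_toSet hTK
  let A0 : Subalgebra k F := (Algebra.adjoin K (T : Set F)).restrictScalars k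
  have hTA0 : ∀ t ∈ T, t ∈ A0 := fun t ht => Algebra.subset_adjoin (R := K) ht
  have hxA0 : x ∈ A0 := (Algebra.adjoin K (T : Set F)).algebraMap_mem
    ⟨x, Algebra.subset_adjoin rfl⟩
  have hA0R : ∀ y ∈ A0, y ∈ A.chart x := by
    intro y hy
    exact Algebra.adjoin_induction (R := K) (p := fun y _ => y ∈ A.chart x)
      (fun t ht => hTR t ht) (fun c => A.adjoinElem_le_chart x (hKR c.2))
      (fun _ _ _ _ => add_mem) (fun _ _ _ _ => mul_mem) hy
  have hkA0 : k ≤ A0.toSubring := fun y hy => A0.algebraMap_mem ⟨y, hy⟩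
  let B : Subalgebra k F := Subring.subalgebraOfLE (S := A0.toSubring.away x hxA0)
    (hkA0.trans (Subring.le_away _ _ _))
  let A1 : Subalgebra k F := B ⊓ Subring.subalgebraOfLE (S := A.chart x⁻¹)
    (hkA.trans (A.le_chart x⁻¹))
  have hA0B : A0 ≤ B := Subring.le_away A0.toSubring x hxA0
  have hGA0 : (G : Set F) ⊆ A0 := fun g hg => by
    have : g ∈ Subalgebra.toSubmodule (Algebra.adjoin K (T : Set F)) :=
      hG ▸ Submodule.subset_span hg
    exact this
  obtain ⟨r', hr'⟩ := (A.chart x⁻¹).exists_pow_mul_mem_of_away x⁻¹ (A.self_mem_chart _) G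
    (fun g hg => by
      refine Subring.chart_inv_le_away ?_
      rw [inv_inv]
      exact hA0R g (hGA0 hg))
  refine ⟨A0, A1, B, hA0B, fun y => Iff.rfl, hA0R,
    fun t ht => hTA0 t (Finset.mem_union_left _ ht),
    fun t ht => ⟨r, hTA0 _ (Finset.mem_union_right _ (Finset.mem_image_of_mem _ ht))⟩, _,
    Submodule.fg_span (Set.Finite.image2 _ (Set.finite_Iio r') G.finite_toSet),
    Subalgebra.le_sup_sup_span hx (G : Set F) A0 A1 B hxA0 hGA0
    (fun a ha => by rw [hG]; exact ha) (fun b hb => hb) r' (fun m hm g hg => ⟨?_, ?_⟩)⟩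
  · exact B.mul_mem (B.pow_mem (Subring.inv_mem_away A0.toSubring x hxA0) _) (hA0B (hGA0 hg))
  · rw [← Nat.sub_add_cancel hm, pow_add, mul_assoc]
    exact mul_mem (pow_mem (A.self_mem_chart _) _) (hr' g hg)

/-- Approximately idempotent functions on the two charts `A[x]`, `A[x⁻¹]` of a projective line
which agree on the overlap, all modulo the ideal `n` of `A`, are induced by an element of `A`. -/
theorem Subring.exists_mem_glue_chart {A : Subring F} (hA : ∀ y : F, IsIntegral A y → y ∈ A)
    {x : F} (hx : x ≠ 0) (n : Ideal A) {b0 b1 : F} (hb0 : b0 ∈ A.chart x) (hb1 : b1 ∈ A.chart x⁻¹)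
    (h0 : ∀ V : ValuationSubring F, A ≤ V.toSubring → (∀ a ∈ n, (a : F) ∈ V.nonunits) → x ∈ V →
      b0 * (1 - b0) ∈ V.nonunits)
    (h1 : ∀ V : ValuationSubring F, A ≤ V.toSubring → (∀ a ∈ n, (a : F) ∈ V.nonunits) → x⁻¹ ∈ V →
      b1 * (1 - b1) ∈ V.nonunits)
    (h01 : ∀ V : ValuationSubring F, A ≤ V.toSubring → (∀ a ∈ n, (a : F) ∈ V.nonunits) → x ∈ V →
      x⁻¹ ∈ V → b0 - b1 ∈ V.nonunits) :
    ∃ c ∈ A, ∀ V : ValuationSubring F, A ≤ V.toSubring → (∀ a ∈ n, (a : F) ∈ V.nonunits) →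
      (x ∈ V → c - b0 ∈ V.nonunits) ∧ (x⁻¹ ∈ V → c - b1 ∈ V.nonunits) := by
  classical
  set R0 := A.chart x
  set R1 := A.chart x⁻¹
  set R01 := R0.away x (A.self_mem_chart x)
  have hR0le : R0 ≤ R01 := Subring.le_away _ _ _
  have hR1le : R1 ≤ R01 := Subring.chart_inv_le_away
  have hxR0 : x ∈ R0 := A.self_mem_chart x
  have hxR1 : x⁻¹ ∈ R1 := A.self_mem_chart x⁻¹
  obtain ⟨k0, l0, hl0, hs0⟩ := Subring.exists_pow_eq_sum_of_forall_nonunits (A.le_chart x) n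
    (mul_mem hb0 (sub_mem (one_mem _) hb0))
    (fun V hV hn => h0 V ((A.le_chart x).trans hV) hn (hV hxR0))
  obtain ⟨k1, l1, hl1, hs1⟩ := Subring.exists_pow_eq_sum_of_forall_nonunits (A.le_chart x⁻¹) n
    (mul_mem hb1 (sub_mem (one_mem _) hb1))
    (fun V hV hn => h1 V ((A.le_chart x⁻¹).trans hV) hn (hV hxR1))
  obtain ⟨k01, l01, hl01, hs01⟩ := Subring.exists_pow_eq_sum_of_forall_nonunits
    ((A.le_chart x).trans hR0le) n (sub_mem (hR0le hb0) (hR1le hb1))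
    (fun V hV hn => h01 V (((A.le_chart x).trans hR0le).trans hV) hn (hV (hR0le hxR0))
      (hV (hR1le hxR1)))
  let T1 : Finset F := insert b1 ((l1.map fun p => (p.2 : F)).toFinset ∪
    (l01.map fun p => (p.2 : F)).toFinset)
  obtain ⟨r, hr⟩ := R0.exists_pow_mul_mem_of_away x hxR0 T1 (by
    intro y hy
    simp only [T1, Finset.mem_insert, Finset.mem_union, List.mem_toFinset, List.mem_map] at hy
    rcases hy with rfl | ⟨p, -, rfl⟩ | ⟨p, -, rfl⟩
    exacts [hR1le hb1, hR1le p.2.2, p.2.2])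
  let T0 : Finset F := insert b0 (l0.map fun p => (p.2 : F)).toFinset
  let T : Finset F := T0 ∪ T1.image (x ^ r * ·)
  have hTR0 : ∀ t ∈ T, t ∈ R0 := by
    intro t ht
    simp only [T, T0, Finset.mem_insert, Finset.mem_union, List.mem_toFinset, List.mem_map,
      Finset.mem_image] at ht
    rcases ht with (rfl | ⟨p, -, rfl⟩) | ⟨y, hy, rfl⟩
    exacts [hb0, p.2.2, hr y hy]
  obtain ⟨s, hsA, hs⟩ := A.exists_finset_isIntegral x T hTR0
  let s' : Finset F := s ∪ ((l0.map fun p => (p.1 : F)).toFinset ∪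
    (l1.map fun p => (p.1 : F)).toFinset ∪ (l01.map fun p => (p.1 : F)).toFinset)
  let k : Subring F := Subring.closure (s' : Set F)
  have hkA : k ≤ A := by
    rw [Subring.closure_le]
    intro y hy
    simp only [s', Finset.coe_union, Set.mem_union, Finset.mem_coe, List.mem_toFinset,
      List.mem_map] at hy
    rcases hy with hy | (⟨p, -, rfl⟩ | ⟨p, -, rfl⟩) | ⟨p, -, rfl⟩
    exacts [hsA hy, p.1.2, p.1.2, p.1.2]
  have : IsNoetherianRing k := is_noetherian_subring_closure _ s'.finite_toSet
  let I : Ideal k := n.comap (Subring.inclusion hkA)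
  have hIV : ∀ V : ValuationSubring F, (∀ a ∈ n, (a : F) ∈ V.nonunits) →
      ∀ a ∈ I, (a : F) ∈ V.nonunits := fun V hV a ha => hV _ ha
  have hfst : ∀ a : A, a ∈ n → (a : F) ∈ k → ∃ a' ∈ I, (a' : F) = a :=
    fun a ha hak => ⟨⟨a, hak⟩, ha, rfl⟩
  have hfst0 : ∀ p ∈ l0, ∃ a ∈ I, (a : F) = p.1 := fun p hp => hfst _ (hl0 p hp)
    (Subring.subset_closure (Finset.mem_union_right _ (Finset.mem_union_left _ (Finset.mem_union_left _ (List.mem_toFinset.2 (List.mem_map_of_mem hp))))))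
  have hfst1 : ∀ p ∈ l1, ∃ a ∈ I, (a : F) = p.1 := fun p hp => hfst _ (hl1 p hp)
    (Subring.subset_closure (Finset.mem_union_right _ (Finset.mem_union_left _ (Finset.mem_union_right _ (List.mem_toFinset.2 (List.mem_map_of_mem hp))))))
  have hfst01 : ∀ p ∈ l01, ∃ a ∈ I, (a : F) = p.1 := fun p hp => hfst _ (hl01 p hp)
    (Subring.subset_closure (Finset.mem_union_right _ (Finset.mem_union_right _ (List.mem_toFinset.2 (List.mem_map_of_mem hp)))))
  have hK : ∀ t ∈ T, IsIntegral (Algebra.adjoin k {x}) t := by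
    intro t ht
    refine Subring.isIntegral_mono (B := (Algebra.adjoin k {x}).toSubring) ?_ (hs t ht)
    rw [Subring.closure_le]
    rintro y (rfl | hy)
    · exact Algebra.subset_adjoin rfl
    · exact (Algebra.adjoin k {x}).algebraMap_mem
        ⟨y, Subring.subset_closure (Finset.mem_union_left _ hy)⟩
  obtain ⟨A0, A1, B, hA0B, hA1, hA0R0, hT0A0, hT1B, L, hL, hcov⟩ := Subring.exists_cover hkA hx T0 T1 r
    (fun t ht => hK t (Finset.mem_union_left _ ht))
    (fun t ht => hK _ (Finset.mem_union_right _ (Finset.mem_image_of_mem _ ht)))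
  have hA1B : A1 ≤ B := fun y hy => ((hA1 y).1 hy).1
  have hl0T : ∀ p ∈ l0, (p.2 : F) ∈ A0 := fun p hp => hT0A0 _
    (Finset.mem_insert_of_mem (List.mem_toFinset.2 (List.mem_map_of_mem hp)))
  have hl1T : ∀ p ∈ l1, (p.2 : F) ∈ A1 := fun p hp => (hA1 _).2 ⟨hT1B _ (Finset.mem_insert_of_mem
    (Finset.mem_union_left _ (List.mem_toFinset.2 (List.mem_map_of_mem hp)))), p.2.2⟩
  have hl01T : ∀ p ∈ l01, (p.2 : F) ∈ B := fun p hp => hT1B _ (Finset.mem_insert_of_mem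
    (Finset.mem_union_right _ (List.mem_toFinset.2 (List.mem_map_of_mem hp))))
  have hb0A0 : b0 ∈ A0 := hT0A0 _ (Finset.mem_insert_self _ _)
  have hb1A1 : b1 ∈ A1 := (hA1 _).2 ⟨hT1B _ (Finset.mem_insert_self _ _), hb1⟩
  obtain ⟨c0, c1, hc, hc0, hc1⟩ := exists_glue I A0 A1 B hA0B hA1B L hL hcov ⟨b0, hb0A0⟩ ⟨b1, hb1A1⟩
    (Subalgebra.mem_radical_of_pow_eq_sum I A0 l0 hfst0 hl0T hs0)
    (Subalgebra.mem_radical_of_pow_eq_sum I A1 l1 hfst1 hl1T hs1)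
    (Subalgebra.mem_radical_of_pow_eq_sum I B l01 hfst01 hl01T hs01)
  refine ⟨c0, Subring.mem_of_mem_chart hA (hA0R0 _ c0.2) (hc ▸ ((hA1 _).1 c1.2).2), fun V hV hn =>
    ⟨fun hxV => ?_, fun hxV => ?_⟩⟩
  · exact Subalgebra.coe_mem_nonunits_of_mem_radical I A0 V
      (fun y hy => Subring.chart_le hV hxV (hA0R0 y hy)) (hIV V hn) hc0
  · rw [hc]
    exact Subalgebra.coe_mem_nonunits_of_mem_radical I A1 V
      (fun y hy => Subring.chart_le hV hxV ((hA1 y).1 hy).2) (hIV V hn) hc1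

/-- The valuation ring `V` contains `A` and its center on `A` contains the ideal `n`. -/
def ValuationSubring.IsCenteredOn (V : ValuationSubring F) {A : Subring F} (n : Ideal A) : Prop :=
  A ≤ V.toSubring ∧ ∀ a ∈ n, (a : F) ∈ V.nonunits

lemma ValuationSubring.IsCenteredOn.mem_nonunits_iff {V : ValuationSubring F} {A : Subring F}
    {n : Ideal A} (h : V.IsCenteredOn n) (hn : n.IsMaximal) (a : A) :
    (a : F) ∈ V.nonunits ↔ a ∈ n := by
  refine ⟨fun ha => ?_, h.2 a⟩
  by_contra han
  obtain ⟨c, hc⟩ := hn.exists_inv han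
  obtain ⟨m, hm, hcm⟩ := hc
  refine V.one_notMem_nonunits ?_
  rw [show (1 : F) = c * a + m by exact_mod_cast hcm.symm]
  exact AddMemClass.add_mem (V.mul_mem_nonunits (h.1 c.2) ha) (h.2 m hm)

lemma ZarClosed.setOf_mem_nonunits {D : Subring F} {C : Set (ValuationSubring F)}
    (hC : ZarClosed D C) (S : Set F) : ZarClosed D {V ∈ C | ∀ a ∈ S, a ∈ V.nonunits} := by
  intro V hDV hV
  refine ⟨hC V hDV fun s hs => ?_, fun a ha => ?_⟩
  · obtain ⟨W, hW, hWs⟩ := hV s hs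
    exact ⟨W, hW.1, hWs⟩
  · rw [ValuationSubring.mem_nonunits_iff_or]
    by_contra! h
    obtain ⟨W, hW, hWs⟩ := hV {a⁻¹} (by simpa using h.2)
    exact W.notMem_nonunits_of_inv_mem h.1 (hWs _ (Finset.mem_singleton_self _)) (hW.2 a ha)

/-- If no maximal ideal of `B` above `n` is dominated from both `C1` and `C2`, some element of `B`
is `0` on `C1` and `1` on `C2`. -/
lemma ZarClosed.exists_mem_separating {D A B : Subring F} {C1 C2 : Set (ValuationSubring F)}
    (h1 : ZarClosed D C1) (h2 : ZarClosed D C2) (hD1 : ∀ V ∈ C1, D ≤ V.toSubring)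
    (hD2 : ∀ V ∈ C2, D ≤ V.toSubring) (hDB : D ≤ B) (hAB : A ≤ B) (n : Ideal A)
    (h : ∀ n' : Ideal B, n'.IsMaximal → (∀ a ∈ n, Subring.inclusion hAB a ∈ n') →
      ¬ ((∃ V ∈ C1, V.IsCenteredOn n') ∧ ∃ V ∈ C2, V.IsCenteredOn n')) :
    ∃ b ∈ B, (∀ V ∈ C1, B ≤ V.toSubring → V.IsCenteredOn n → b ∈ V.nonunits) ∧
      ∀ V ∈ C2, B ≤ V.toSubring → V.IsCenteredOn n → 1 - b ∈ V.nonunits := by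
  let J : Set (ValuationSubring F) → Ideal B := fun C =>
    { carrier := {b | ∀ V ∈ C, B ≤ V.toSubring → V.IsCenteredOn n → (b : F) ∈ V.nonunits}
      zero_mem' := fun V _ _ _ => zero_mem _
      add_mem' := fun ha hb V hV hB hc => add_mem (ha V hV hB hc) (hb V hV hB hc)
      smul_mem' := fun c a ha V hV hB hc => V.mul_mem_nonunits (hB c.2) (ha V hV hB hc) }
  by_cases hJ : J C1 ⊔ J C2 = ⊤
  · obtain ⟨b, hb, b', hb', hbb⟩ := Submodule.mem_sup.1 ((Ideal.eq_top_iff_one _).1 hJ)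
    refine ⟨b, b.2, hb, fun V hV hB hc => ?_⟩
    have : (1 : F) - b = b' := by
      rw [sub_eq_iff_eq_add']; exact_mod_cast hbb.symm
    rw [this]
    exact hb' V hV hB hc
  · exfalso
    obtain ⟨n', hn', hle⟩ := Ideal.exists_le_maximal _ hJ
    have key : ∀ C, ZarClosed D C → (∀ V ∈ C, D ≤ V.toSubring) → J C ≤ n' →
        ∃ V ∈ C, V.IsCenteredOn n' := by
      intro C hC hDC hJC
      have := hn'.isPrime
      obtain ⟨V, hV, hBV, hVn⟩ := (hC.setOf_mem_nonunits ((↑) '' (n : Set A))).exists_mem_centered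
        (fun V hV => hDC V hV.1) B hDB n' (fun b hb => hJC fun V hV hB hc => hb V
          ⟨hV, by rintro _ ⟨a, ha, rfl⟩; exact hc.2 a ha⟩ hB)
      exact ⟨V, hV.1, hBV, hVn⟩
    refine h n' hn' (fun a ha => hle (Submodule.mem_sup_left ?_))
      ⟨key C1 h1 hD1 (le_sup_left.trans hle), key C2 h2 hD2 (le_sup_right.trans hle)⟩
    exact fun V _ _ hc => hc.2 a ha

/-- The valuation rings centered on a maximal ideal of an integrally closed ring do not split into
two closed sets separated by finitely many elements. -/
theorem ZarClosed.not_separated {D : Subring F} {C1 C2 : Set (ValuationSubring F)}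
    (h1 : ZarClosed D C1) (h2 : ZarClosed D C2) (hD1 : ∀ V ∈ C1, D ≤ V.toSubring)
    (hD2 : ∀ V ∈ C2, D ≤ V.toSubring) (E : Finset F) :
    ∀ A : Subring F, D ≤ A → (∀ y : F, IsIntegral A y → y ∈ A) → ∀ n : Ideal A, n.IsMaximal →
      (∀ V : ValuationSubring F, V.IsCenteredOn n → V ∈ C1 ∨ V ∈ C2) →
      (∀ V ∈ C1, V.IsCenteredOn n → ∀ W ∈ C2, W.IsCenteredOn n → ∃ x ∈ E, ¬ (x ∈ V ↔ x ∈ W)) →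
      ¬ ((∃ V ∈ C1, V.IsCenteredOn n) ∧ ∃ V ∈ C2, V.IsCenteredOn n) := by
  classical
  induction E using Finset.induction_on with
  | empty =>
    rintro A - - n - - hE ⟨⟨V, hV, hVn⟩, W, hW, hWn⟩
    simpa using hE V hV hVn W hW hWn
  | insert x E _ ih =>
    rintro A hDA hA n hn hcov hE ⟨⟨V, hV, hVn⟩, W, hW, hWn⟩
    rcases eq_or_ne x 0 with rfl | hx
    · refine ih A hDA hA n hn hcov (fun V hV hVn W hW hWn => ?_) ⟨⟨V, hV, hVn⟩, W, hW, hWn⟩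
      obtain ⟨z, hz, hzVW⟩ := hE V hV hVn W hW hWn
      rcases Finset.mem_insert.1 hz with rfl | hz
      · exact absurd (by simp [zero_mem]) hzVW
      · exact ⟨z, hz, hzVW⟩
    have key : ∀ y : F, y = x ∨ y = x⁻¹ → ∃ b ∈ A.chart y,
        (∀ V ∈ C1, V.IsCenteredOn n → y ∈ V → b ∈ V.nonunits) ∧
        ∀ V ∈ C2, V.IsCenteredOn n → y ∈ V → 1 - b ∈ V.nonunits := by
      intro y hy
      have hy0 : y ≠ 0 := by rcases hy with rfl | rfl <;> simpa
      obtain ⟨b, hb, hb1, hb2⟩ := h1.exists_mem_separating h2 hD1 hD2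
        (hDA.trans (A.le_chart y)) (A.le_chart y) n (by
          intro n' hn' hnn'
          have hcen : ∀ V : ValuationSubring F, V.IsCenteredOn n' → V.IsCenteredOn n :=
            fun V hV => ⟨(A.le_chart y).trans hV.1, fun a ha => hV.2 _ (hnn' a ha)⟩
          have hyV : ∀ V : ValuationSubring F, V.IsCenteredOn n' → y ∈ V :=
            fun V hV => hV.1 (A.self_mem_chart y)
          have hyi : ∀ V : ValuationSubring F, V.IsCenteredOn n' →
              (y⁻¹ ∈ V ↔ (⟨y, A.self_mem_chart y⟩ : A.chart y) ∉ n') := by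
            intro V hV
            rw [← hV.mem_nonunits_iff hn', ValuationSubring.mem_nonunits_iff_or]
            simp [hy0]
          refine ih _ (hDA.trans (A.le_chart y)) (fun z => Subring.mem_chart_of_isIntegral) n' hn'
            (fun V hV => hcov V (hcen V hV)) fun V hV hVn W hW hWn => ?_
          obtain ⟨z, hz, hzVW⟩ := hE V hV (hcen V hVn) W hW (hcen W hWn)
          rcases Finset.mem_insert.1 hz with rfl | hz
          · refine absurd ?_ hzVW
            rcases hy with rfl | rfl
            · exact iff_of_true (hyV V hVn) (hyV W hWn)
            · rw [inv_inv] at hyi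
              rw [hyi V hVn, hyi W hWn]
          · exact ⟨z, hz, hzVW⟩)
      exact ⟨b, hb, fun V hV hVn hyV => hb1 V hV (Subring.chart_le hVn.1 hyV) hVn,
        fun V hV hVn hyV => hb2 V hV (Subring.chart_le hVn.1 hyV) hVn⟩
    have idem : ∀ y b : F, b ∈ A.chart y →
        (∀ V ∈ C1, V.IsCenteredOn n → y ∈ V → b ∈ V.nonunits) →
        (∀ V ∈ C2, V.IsCenteredOn n → y ∈ V → 1 - b ∈ V.nonunits) →
        ∀ V : ValuationSubring F, A ≤ V.toSubring → (∀ a ∈ n, (a : F) ∈ V.nonunits) → y ∈ V →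
          b * (1 - b) ∈ V.nonunits := by
      intro y b hb hb1 hb2 V hAV hnV hyV
      have hbV : b ∈ V := Subring.chart_le hAV hyV hb
      rcases hcov V ⟨hAV, hnV⟩ with hV | hV
      · rw [mul_comm]
        exact V.mul_mem_nonunits (sub_mem (one_mem _) hbV) (hb1 V hV ⟨hAV, hnV⟩ hyV)
      · exact V.mul_mem_nonunits hbV (hb2 V hV ⟨hAV, hnV⟩ hyV)
    obtain ⟨b0, hb0, hb01, hb02⟩ := key x (Or.inl rfl)
    obtain ⟨b1, hb1, hb11, hb12⟩ := key x⁻¹ (Or.inr rfl)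
    obtain ⟨c, hcA, hc⟩ := Subring.exists_mem_glue_chart hA hx n hb0 hb1 (idem x b0 hb0 hb01 hb02)
      (idem x⁻¹ b1 hb1 hb11 hb12) (fun V hAV hnV hxV hxV' => by
        rcases hcov V ⟨hAV, hnV⟩ with hV | hV
        · exact sub_mem (hb01 V hV ⟨hAV, hnV⟩ hxV) (hb11 V hV ⟨hAV, hnV⟩ hxV')
        · rw [← sub_sub_sub_cancel_left b1 b0 1]
          exact sub_mem (hb12 V hV ⟨hAV, hnV⟩ hxV') (hb02 V hV ⟨hAV, hnV⟩ hxV))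
    have hcV : c ∈ V.nonunits := by
      rcases V.mem_or_inv_mem x with h | h
      · rw [← sub_add_cancel c b0]
        exact add_mem ((hc V hVn.1 hVn.2).1 h) (hb01 V hV hVn h)
      · rw [← sub_add_cancel c b1]
        exact add_mem ((hc V hVn.1 hVn.2).2 h) (hb11 V hV hVn h)
    have hcW : 1 - c ∈ W.nonunits := by
      rcases W.mem_or_inv_mem x with h | h
      · rw [← sub_sub_sub_cancel_right 1 c b0]
        exact sub_mem (hb02 W hW hWn h) ((hc W hWn.1 hWn.2).1 h)
      · rw [← sub_sub_sub_cancel_right 1 c b1]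
        exact sub_mem (hb12 W hW hWn h) ((hc W hWn.1 hWn.2).2 h)
    have hcn := (hVn.mem_nonunits_iff hn ⟨c, hcA⟩).1 hcV
    have hcn' := (hWn.mem_nonunits_iff hn (1 - ⟨c, hcA⟩)).1 hcW
    refine hn.ne_top ((Ideal.eq_top_iff_one n).2 ?_)
    rw [← sub_add_cancel 1 (⟨c, hcA⟩ : A)]
    exact add_mem hcn' hcn

lemma memMaxIdeal_iff {R : Subring F} {x : F} : MemMaxIdeal R x ↔ x ∈ R ∧ (x = 0 ∨ x⁻¹ ∉ R) := by
  refine ⟨fun ⟨h, hu⟩ => ⟨h, ?_⟩, fun ⟨h, hx⟩ => ⟨h, fun hu => ?_⟩⟩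
  · by_contra! hc
    exact hu (IsUnit.of_mul_eq_one ⟨x⁻¹, hc.2⟩ (Subtype.ext (mul_inv_cancel₀ hc.1)))
  · obtain ⟨⟨y, hy⟩, hxy⟩ := hu.exists_right_inv
    have hxy' : x * y = 1 := congrArg Subtype.val hxy
    rcases hx with rfl | hx
    · simp at hxy'
    · exact hx (by rwa [← eq_inv_of_mul_eq_one_right hxy'])

lemma ValuationSubring.memMaxIdeal_iff {V : ValuationSubring F} {x : F} :
    MemMaxIdeal V.toSubring x ↔ x ∈ V.nonunits := by
  rw [_root_.memMaxIdeal_iff, V.mem_nonunits_iff_or]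
  refine ⟨fun h => h.2, fun h => ⟨?_, h⟩⟩
  rcases h with rfl | h
  · exact V.zero_mem'
  · exact (V.mem_or_inv_mem' x).resolve_right h

lemma ValuationSubring.toSubring_mem_domSet {D : Subring F} {V : ValuationSubring F}
    (hDV : D ≤ V.toSubring) (hV : ∀ d, MemMaxIdeal D d → d ∈ V.nonunits) :
    V.toSubring ∈ domSet D := by
  refine ⟨fun x _ => V.mem_or_inv_mem' x, hDV, fun x hx => ⟨fun h => ?_, fun h => ?_⟩⟩
  · exact V.memMaxIdeal_iff.2 (hV x h)
  · rw [_root_.memMaxIdeal_iff] at h ⊢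
    exact ⟨hx, h.2.imp_right fun h' h'' => h' (hDV h'')⟩

/-- A point of `Dom_F(D)` as a valuation subring. -/
def domSet.toValuationSubring {D : Subring F} (z : domSet D) : ValuationSubring F where
  toSubring := z.1
  mem_or_inv_mem' x := by
    rcases eq_or_ne x 0 with rfl | hx
    · exact Or.inl z.1.zero_mem
    · exact z.2.1 x hx

lemma domSet.le_toValuationSubring {D : Subring F} (z : domSet D) :
    D ≤ (domSet.toValuationSubring z).toSubring := z.2.2.1

lemma domSet.mem_nonunits {D : Subring F} (z : domSet D) {d : F} (hd : MemMaxIdeal D d) :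
    d ∈ (domSet.toValuationSubring z).nonunits :=
  ValuationSubring.memMaxIdeal_iff.1 ((z.2.2.2 d hd.1).1 hd)

lemma domSet.isOpen_exists_finset {D : Subring F} {U : Set (domSet D)}
    (hU : @IsOpen _ (zariskiTop (domSet D)) U) {z : domSet D} (hz : z ∈ U) :
    ∃ s : Finset F, (∀ x ∈ s, x ∈ z.1) ∧ ∀ w : domSet D, (∀ x ∈ s, x ∈ w.1) → w ∈ U := by
  classical
  induction hU with
  | basic U hU =>
    obtain ⟨s, rfl⟩ := hU
    exact ⟨s, hz, fun w hw => hw⟩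
  | univ => exact ⟨∅, by simp, fun _ _ => trivial⟩
  | inter U V _ _ ihU ihV =>
    obtain ⟨s, hs, hsU⟩ := ihU hz.1
    obtain ⟨t, ht, htV⟩ := ihV hz.2
    refine ⟨s ∪ t, fun x hx => (Finset.mem_union.1 hx).elim (hs x) (ht x), fun w hw => ⟨?_, ?_⟩⟩
    · exact hsU w fun x hx => hw x (Finset.mem_union_left _ hx)
    · exact htV w fun x hx => hw x (Finset.mem_union_right _ hx)
  | sUnion S _ ih =>
    obtain ⟨U, hU, hzU⟩ := hz
    obtain ⟨s, hs, hsU⟩ := ih U hU hzU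
    exact ⟨s, hs, fun w hw => ⟨U, hU, hsU w hw⟩⟩

lemma domSet.zarClosed_image {D : Subring F} {Z : Set (domSet D)}
    (hZ : @IsClosed _ (zariskiTop (domSet D)) Z) : ZarClosed D (toValuationSubring '' Z) := by
  intro V hDV hV
  have hmem : V.toSubring ∈ domSet D := by
    refine V.toSubring_mem_domSet hDV fun d hd => ?_
    rw [V.mem_nonunits_iff_or]
    by_contra! hc
    obtain ⟨_, ⟨w, -, rfl⟩, hw⟩ := hV {d⁻¹} (by simpa using hc.2)
    exact (toValuationSubring w).notMem_nonunits_of_inv_mem hc.1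
      (hw _ (Finset.mem_singleton_self _)) (domSet.mem_nonunits w hd)
  refine ⟨⟨V.toSubring, hmem⟩, ?_, rfl⟩
  by_contra hz
  have hZ' : @IsOpen _ (zariskiTop (domSet D)) Zᶜ :=
    @IsClosed.isOpen_compl _ (zariskiTop (domSet D)) Z hZ
  obtain ⟨s, hs, hsZ⟩ := isOpen_exists_finset hZ' hz
  obtain ⟨_, ⟨w, hwZ, rfl⟩, hw⟩ := hV s hs
  exact hsZ w hw hwZ

lemma domSet.isClosed_preimage {D : Subring F} {C : Set (ValuationSubring F)}
    (hC : ZarClosed D C) :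
    @IsClosed _ (zariskiTop (domSet D)) (toValuationSubring ⁻¹' C : Set (domSet D)) := by
  let := zariskiTop (domSet D)
  rw [← isOpen_compl_iff, isOpen_iff_forall_mem_open]
  intro z hz
  have : ∃ s : Finset F, (∀ x ∈ s, x ∈ z.1) ∧
      ∀ W ∈ C, ¬ ∀ x ∈ s, x ∈ W := by
    by_contra! h
    exact hz (hC _ (domSet.le_toValuationSubring z) h)
  obtain ⟨s, hs, hsC⟩ := this
  exact ⟨{w | ∀ x ∈ s, x ∈ w.1}, fun w hw hwC => hsC _ hwC hw,
    TopologicalSpace.isOpen_generateFrom_of_mem ⟨s, rfl⟩, hs⟩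

lemma domSet.forall_le_of_image {D : Subring F} (Z : Set (domSet D)) :
    ∀ V ∈ toValuationSubring '' Z, D ≤ V.toSubring := by
  rintro _ ⟨z, -, rfl⟩
  exact (domSet.le_toValuationSubring z)

lemma domSet.toValuationSubring_injective {D : Subring F} :
    Function.Injective (toValuationSubring : domSet D → ValuationSubring F) :=
  fun _ _ h => Subtype.ext (congrArg ValuationSubring.toSubring h)

lemma IsLocalRing.coe_mem_maximalIdeal_iff {R : Subring F} [IsLocalRing R] {a : R} :
    a ∈ IsLocalRing.maximalIdeal R ↔ MemMaxIdeal R a :=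
  ⟨fun h => ⟨a.2, h⟩, fun ⟨_, h⟩ => h⟩

lemma integrallyClosedIn_iff {R : Subring F} :
    IntegrallyClosedIn R ↔ ∀ y : F, IsIntegral R y → y ∈ R :=
  forall_congr' fun _ => by rw [Subring.isIntegral_iff_exists_poly]

open Polynomial in
/-- The valuation rings centered on the maximal ideal of `R` form a Zariski closed set when `R` is
residually algebraic over `D`. -/
lemma zarClosed_setOf_isCenteredOn {D R : Subring F} [IsLocalRing R]
    (hres : ResiduallyAlgebraic D R) :
    ZarClosed D {V | V.IsCenteredOn (IsLocalRing.maximalIdeal R)} := by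
  intro V hDV hV
  have hcen : ∀ a ∈ IsLocalRing.maximalIdeal R, (a : F) ∈ V.nonunits := by
    intro a ha
    rw [ValuationSubring.mem_nonunits_iff_or]
    by_contra! h
    obtain ⟨W, hW, hWs⟩ := hV {(a : F)⁻¹} (by simpa using h.2)
    exact W.notMem_nonunits_of_inv_mem h.1 (hWs _ (Finset.mem_singleton_self _)) (hW.2 a ha)
  refine ⟨fun x hx => ?_, hcen⟩
  obtain ⟨p, hp, hpD, hpx⟩ := hres x hx
  have hpV : p.eval x ∈ V.nonunits :=
    hcen ⟨_, hpx.1⟩ (IsLocalRing.coe_mem_maximalIdeal_iff.2 hpx)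
  have hdeg : p.natDegree ≠ 0 := by
    intro h0
    rw [hp.natDegree_eq_zero.1 h0, eval_one] at hpV
    exact V.one_notMem_nonunits hpV
  refine V.mem_of_isIntegral (B := V.toSubring) le_rfl ?_
  have hc' : (p.coeffs : Set F) ⊆ V.toSubring := by
    intro y hy
    obtain ⟨i, -, rfl⟩ := mem_coeffs_iff.1 hy
    exact hDV (hpD i)
  refine IsIntegral.of_aeval_monic ((monic_toSubring p V.toSubring hc').2 hp)
    (by rwa [natDegree_toSubring]) ?_
  have : aeval x (p.toSubring V.toSubring hc') = p.eval x := by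
    rw [aeval_def, ← eval_map]
    congr 1
    ext i
    rw [coeff_map]
    exact coeff_toSubring p _ hc'
  rw [this]
  exact isIntegral_algebraMap (R := V.toSubring) (A := F) (x := ⟨_, V.nonunits_subset hpV⟩)

/-- The points of `Dom_F(D)` dominating `R`. -/
def domPointsOver (D R : Subring F) [IsLocalRing R] : Set (domSet D) :=
  domSet.toValuationSubring ⁻¹' {V | V.IsCenteredOn (IsLocalRing.maximalIdeal R)}

lemma exists_mem_domPointsOver {D R : Subring F} [IsLocalRing R] (hdom : Dominates R D)
    {V : ValuationSubring F} (hV : V.IsCenteredOn (IsLocalRing.maximalIdeal R)) :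
    ∃ z ∈ domPointsOver D R, (domSet.toValuationSubring z) = V := by
  have hmem : V.toSubring ∈ domSet D :=
    V.toSubring_mem_domSet (hdom.1.trans hV.1) fun d hd =>
      hV.2 ⟨d, hdom.1 hd.1⟩ (IsLocalRing.coe_mem_maximalIdeal_iff.2 ((hdom.2 d hd.1).1 hd))
  exact ⟨⟨_, hmem⟩, hV, rfl⟩

lemma nonempty_domPointsOver {D R : Subring F} [IsLocalRing R] (hdom : Dominates R D) :
    (domPointsOver D R).Nonempty := by
  obtain ⟨V, hRV, hV⟩ := Ideal.image_subset_nonunits_valuationSubring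
    (IsLocalRing.maximalIdeal R) (IsLocalRing.maximalIdeal.isMaximal R).ne_top
  obtain ⟨z, hz, -⟩ := exists_mem_domPointsOver (D := D) hdom
    (V := V) ⟨hRV, fun a ha => hV ⟨a, ha, rfl⟩⟩
  exact ⟨z, hz⟩

lemma coe_eq_iInter_domPointsOver {D R : Subring F} [IsLocalRing R] (hdom : Dominates R D)
    (hint : IntegrallyClosedIn R) : (R : Set F) = ⋂ z ∈ domPointsOver D R, (z.1 : Set F) := by
  refine Set.Subset.antisymm (Set.subset_iInter₂ fun z hz => hz.1) fun y hy => ?_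
  by_contra hyR
  have hR : IsIntegrallyClosedIn R F := by
    exact Subring.isIntegrallyClosedIn_iff.2 fun {z} hz => integrallyClosedIn_iff.1 hint z hz
  obtain ⟨V, hRV, hyV⟩ := LocalSubring.exists_le_valuationSubring_of_isIntegrallyClosedIn (R := ⟨R⟩) hyR
  obtain ⟨hle, hloc⟩ := LocalSubring.le_def.1 hRV
  obtain ⟨z, hz, rfl⟩ := exists_mem_domPointsOver (V := V) hdom ⟨hle, fun a ha => by
    rw [← V.memMaxIdeal_iff]
    exact ⟨hle a.2, fun hu => ha (hloc.map_nonunit a hu)⟩⟩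
  exact hyV (Set.mem_iInter₂.1 hy z hz)

lemma isPreconnected_domPointsOver {D R : Subring F} [IsLocalRing R] (hdom : Dominates R D)
    (hres : ResiduallyAlgebraic D R) (hint : IntegrallyClosedIn R) :
    @IsPreconnected _ (zariskiTop (domSet D)) (domPointsOver D R) := by
  let := zariskiTop (domSet D)
  have hcl : IsClosed (domPointsOver D R) :=
    domSet.isClosed_preimage (zarClosed_setOf_isCenteredOn hres)
  rw [isPreconnected_closed_iff]
  intro t t' ht ht' hcov ⟨z, hz⟩ ⟨z', hz'⟩
  by_contra hne
  have hdisj : Disjoint (domSet.toValuationSubring '' (domPointsOver D R ∩ t))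
      (domSet.toValuationSubring '' (domPointsOver D R ∩ t')) := by
    rw [Set.disjoint_image_iff domSet.toValuationSubring_injective, Set.disjoint_left]
    exact fun w hw hw' => hne ⟨w, hw.1, hw.2, hw'.2⟩
  have h1 := domSet.zarClosed_image (hcl.inter ht)
  have h2 := domSet.zarClosed_image (hcl.inter ht')
  obtain ⟨E, hE⟩ := h1.exists_finset_separating h2 (domSet.forall_le_of_image _)
    (domSet.forall_le_of_image _) hdisj
  refine ZarClosed.not_separated (F := F) h1 h2 (domSet.forall_le_of_image _)
    (domSet.forall_le_of_image _) E R hdom.1 (integrallyClosedIn_iff.1 hint)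
    (IsLocalRing.maximalIdeal R) (IsLocalRing.maximalIdeal.isMaximal R) (fun V hV => ?_)
    (fun V hV _ W hW _ => hE V hV W hW)
    ⟨⟨_, ⟨z, hz, rfl⟩, hz.1⟩, ⟨_, ⟨z', hz', rfl⟩, hz'.1⟩⟩
  obtain ⟨w, hw, rfl⟩ := exists_mem_domPointsOver hdom hV
  exact (hcov hw).imp (fun h => ⟨w, ⟨hw, h⟩, rfl⟩) fun h => ⟨w, ⟨hw, h⟩, rfl⟩

open Polynomial in
lemma Polynomial.eval₂_mem_valuationSubring {V : ValuationSubring F} {D : Subring F}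
    (hD : D ≤ V.toSubring) {x : F} (hx : x ∈ V) (q : D[X]) : q.eval₂ D.subtype x ∈ V := by
  rw [eval₂_eq_sum_range]
  exact sum_mem fun i _ => mul_mem (hD (q.coeff i).2) (pow_mem hx i)

open Polynomial in
lemma ZarClosed.exists_monic_eval_mem_nonunits {D : Subring F} [IsLocalRing D]
    {C : Set (ValuationSubring F)} (hC : ZarClosed D C) (hD : ∀ V ∈ C, D ≤ V.toSubring)
    {x : F} (hx : ∀ V ∈ C, x ∈ V) {V : ValuationSubring F} (hV : V ∈ C) :
    ∃ p : D[X], p.Monic ∧ p.eval₂ D.subtype x ∈ V.nonunits := by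
  by_contra! h
  have hxV : x ∉ V.nonunits := by simpa using h X monic_X
  obtain ⟨hx0, hxi⟩ : x ≠ 0 ∧ x⁻¹ ∈ V := by
    rw [V.mem_nonunits_iff_or] at hxV
    push Not at hxV
    exact hxV
  obtain ⟨V', hV'V, hV', hn⟩ := exists_valuationSubring_le (eval₂RingHom D.subtype x⁻¹) V
    (eval₂_mem_valuationSubring (hD V hV) hxi)
    ((IsLocalRing.maximalIdeal D).comap constantCoeff) (fun q hq hqV => by
      have hu : IsUnit ((1 - q).coeff 0) := by
        have : q.coeff 0 ∈ IsLocalRing.maximalIdeal D := hq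
        by_contra hnu
        have := add_mem ((IsLocalRing.mem_maximalIdeal _).2 hnu) this
        rw [coeff_sub, coeff_one_zero, sub_add_cancel] at this
        exact (Ideal.ne_top_iff_one _).1 (IsLocalRing.maximalIdeal.isMaximal D).ne_top this
      obtain ⟨u, hu⟩ := hu
      have htc : (1 - q).trailingCoeff = u := by
        rw [trailingCoeff_eq_coeff_zero (by rw [← hu]; exact u.ne_zero), hu]
      refine h (Polynomial.C ((u⁻¹ : Dˣ) : D) * (1 - q).reverse) ?_ ?_
      · rw [Monic, leadingCoeff_C_mul_of_isUnit (Units.isUnit _), reverse_leadingCoeff, htc]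
        simp
      · have hx' : x ∈ V := hx V hV
        let : Invertible x⁻¹ := invertibleOfNonzero (inv_ne_zero hx0)
        have key := eval₂_reverse_mul_pow D.subtype x⁻¹ (1 - q)
        rw [invOf_eq_inv, inv_inv, inv_pow, mul_inv_eq_iff_eq_mul₀ (pow_ne_zero _ hx0)] at key
        rw [eval₂_mul, eval₂_C, key, mul_comm (eval₂ _ _ _)]
        refine V.mul_mem_nonunits (hD V hV (SetLike.coe_mem _))
          (V.mul_mem_nonunits (pow_mem hx' _) ?_)
        simpa [eval₂_sub] using hqV)
  have hDV' : D ≤ V'.toSubring := fun d hd => by simpa using hV' (Polynomial.C ⟨d, hd⟩)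
  have hV'C : V' ∈ C := hC.mem_of_le hDV' hV'V hV
  refine V'.notMem_nonunits_of_inv_mem (inv_ne_zero hx0) ?_ (by simpa using hn X (by simp))
  rw [inv_inv]
  exact hx V' hV'C

open Polynomial in
lemma ZarClosed.exists_monic_forall_eval_mem_nonunits {D : Subring F} [IsLocalRing D]
    {C : Set (ValuationSubring F)} (hC : ZarClosed D C) (hD : ∀ V ∈ C, D ≤ V.toSubring)
    {x : F} (hx : ∀ V ∈ C, x ∈ V) :
    ∃ p : D[X], p.Monic ∧ ∀ V ∈ C, p.eval₂ D.subtype x ∈ V.nonunits := by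
  by_contra! h
  let M : Submonoid D[X] :=
    { carrier := {p | p.Monic}
      one_mem' := monic_one
      mul_mem' := Monic.mul }
  choose V hVC hV using fun p : M => h p p.2
  obtain ⟨U, hU⟩ := exists_ultrafilter_dvd M
  have hW := hC.ultraLimit_mem hD U V hVC
  obtain ⟨p, hp, hpW⟩ := hC.exists_monic_eval_mem_nonunits hD hx hW
  have hev : ∀ᶠ t in (U : Filter M), p.eval₂ D.subtype x ∉ (V t).nonunits := by
    filter_upwards [hU ⟨p, hp⟩] with t ht hpt
    obtain ⟨r, rfl⟩ := ht
    refine hV (⟨p, hp⟩ * r) ?_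
    have hr : (r : D[X]).eval₂ D.subtype x ∈ V (⟨p, hp⟩ * r) := 
      eval₂_mem_valuationSubring (hD _ (hVC _)) (hx _ (hVC _)) _
    rw [Submonoid.coe_mul, eval₂_mul, mul_comm (eval₂ _ _ _)]
    exact (V _).mul_mem_nonunits hr hpt
  have h0 : p.eval₂ D.subtype x ≠ 0 := by
    intro h0
    obtain ⟨t, ht⟩ := hev.exists
    exact ht (by rw [h0]; exact zero_mem _)
  refine (ultraLimit U V).notMem_nonunits_of_inv_mem h0 ?_ hpW
  rw [mem_ultraLimit]
  filter_upwards [hev] with t ht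
  rw [ValuationSubring.mem_nonunits_iff_or] at ht
  push Not at ht
  exact ht.2

open Polynomial in
/-- A polynomial with a coefficient outside the ideal `I` is, up to a polynomial with coefficients
in `I`, a power of `X` times a polynomial with constant coefficient outside `I`. -/
lemma Polynomial.exists_eq_X_pow_mul_add {A : Type*} [CommRing A] (I : Ideal A) (i : ℕ) :
    ∀ P : A[X], P.coeff i ∉ I → ∃ (e : ℕ) (Q L : A[X]), P = X ^ e * Q + L ∧ Q.coeff 0 ∉ I ∧
      ∀ j, L.coeff j ∈ I := by
  induction i with
  | zero => exact fun P hP => ⟨0, P, 0, by simp, hP, by simp⟩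
  | succ i ih =>
    intro P hP
    by_cases h0 : P.coeff 0 ∈ I
    · obtain ⟨e, Q, L, hQL, hQ, hL⟩ := ih P.divX (by rwa [coeff_divX])
      refine ⟨e + 1, Q, L * X + C (P.coeff 0), ?_, hQ, fun j => ?_⟩
      · conv_lhs => rw [← divX_mul_X_add P, hQL]
        ring
      · rw [coeff_add]
        refine add_mem ?_ ?_
        · cases j with
          | zero => simp
          | succ j => rw [coeff_mul_X]; exact hL j
        · rw [coeff_C]; split_ifs
          exacts [h0, zero_mem _]
    · exact ⟨0, P, 0, by simp, h0, by simp⟩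

open Polynomial in
/-- On a connected closed set, an element of all the valuation rings is a nonunit everywhere or
nowhere. -/
lemma domSet.mem_nonunits_of_mem_nonunits {D : Subring F} [IsLocalRing D] {Z : Set (domSet D)}
    (hZ : @IsClosed _ (zariskiTop (domSet D)) Z)
    (hZc : @IsPreconnected _ (zariskiTop (domSet D)) Z) {x : F} (hx : ∀ z ∈ Z, x ∈ z.1)
    {z z' : domSet D} (hz : z ∈ Z) (hz' : z' ∈ Z)
    (hxz : x ∈ (domSet.toValuationSubring z).nonunits) :
    x ∈ (domSet.toValuationSubring z').nonunits := by
  let := zariskiTop (domSet D)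
  have hC := domSet.zarClosed_image hZ
  have hm : ∀ w : domSet D, ∀ d ∈ IsLocalRing.maximalIdeal D,
      (d : F) ∈ (toValuationSubring w).nonunits := fun w d hd =>
    domSet.mem_nonunits w (IsLocalRing.coe_mem_maximalIdeal_iff.1 hd)
  obtain ⟨P, hP, hPZ⟩ := hC.exists_monic_forall_eval_mem_nonunits (domSet.forall_le_of_image _)
    (x := x) (by rintro _ ⟨w, hw, rfl⟩; exact hx w hw)
  obtain ⟨e, Q, L, rfl, hQ, hL⟩ := exists_eq_X_pow_mul_add (IsLocalRing.maximalIdeal D)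
    P.natDegree P (by
      rw [hP.coeff_natDegree]
      exact (Ideal.ne_top_iff_one _).1 (IsLocalRing.maximalIdeal.isMaximal D).ne_top)
  have hQZ : ∀ w ∈ Z, x ^ e * Q.eval₂ D.subtype x ∈ (toValuationSubring w).nonunits := by
    intro w hw
    have hL' : L.eval₂ D.subtype x ∈ (toValuationSubring w).nonunits := by
      rw [eval₂_eq_sum_range]
      refine sum_mem fun i _ => ?_
      rw [mul_comm]
      exact (toValuationSubring w).mul_mem_nonunits (pow_mem (hx w hw) i) (hm w _ (hL i))
    have := sub_mem (hPZ _ ⟨w, hw, rfl⟩) hL'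
    simpa [eval₂_add, eval₂_mul, eval₂_pow] using this
  have hdisj : ∀ w ∈ Z, x ∈ (toValuationSubring w).nonunits →
      Q.eval₂ D.subtype x ∉ (toValuationSubring w).nonunits := by
    intro w hw hxw hQw
    have hdiv : Q.divX.eval₂ D.subtype x * x ∈ (toValuationSubring w).nonunits :=
      (toValuationSubring w).mul_mem_nonunits
        (eval₂_mem_valuationSubring (domSet.le_toValuationSubring w) (hx w hw) _) hxw
    have h0 := sub_mem hQw hdiv
    have hQ0 : Q.eval₂ D.subtype x - Q.divX.eval₂ D.subtype x * x = (Q.coeff 0 : F) := by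
      conv_lhs => rw [← divX_mul_X_add Q, eval₂_add, eval₂_mul, eval₂_X, eval₂_C,
        divX_mul_X_add, add_sub_cancel_left, Subring.subtype_apply]
    rw [hQ0] at h0
    have h0' := (w.2.2.2 _ (Q.coeff 0).2).2 ((toValuationSubring w).memMaxIdeal_iff.2 h0)
    exact hQ (IsLocalRing.coe_mem_maximalIdeal_iff.2 h0')
  by_contra hxz'
  have hcl : ∀ y : F, IsClosed (toValuationSubring ⁻¹'
      {V ∈ toValuationSubring '' Z | ∀ a ∈ ({y} : Set F), a ∈ V.nonunits} : Set (domSet D)) :=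
    fun y => domSet.isClosed_preimage (hC.setOf_mem_nonunits {y})
  have hmem : ∀ y : F, ∀ w ∈ Z, y ∈ (toValuationSubring w).nonunits →
      w ∈ (toValuationSubring ⁻¹'
        {V ∈ toValuationSubring '' Z | ∀ a ∈ ({y} : Set F), a ∈ V.nonunits} : Set (domSet D)) :=
    fun y w hw hy => ⟨⟨w, hw, rfl⟩, by rintro _ rfl; exact hy⟩
  have hcov : ∀ w ∈ Z, x ∉ (toValuationSubring w).nonunits →
      Q.eval₂ D.subtype x ∈ (toValuationSubring w).nonunits := by
    intro w hw hxw
    rw [ValuationSubring.mem_nonunits_iff_or] at hxw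
    push Not at hxw
    have := (toValuationSubring w).mul_mem_nonunits (pow_mem hxw.2 e) (hQZ w hw)
    rwa [inv_pow, inv_mul_cancel_left₀ (pow_ne_zero _ hxw.1)] at this
  obtain ⟨w, hw, hw1, hw2⟩ := isPreconnected_closed_iff.1 hZc _ _ (hcl x)
    (hcl (Q.eval₂ D.subtype x))
    (fun w hw => by
      by_cases hxw : x ∈ (toValuationSubring w).nonunits
      · exact Or.inl (hmem x w hw hxw)
      · exact Or.inr (hmem _ w hw (hcov w hw hxw)))
    ⟨z, hz, hmem x z hz hxz⟩ ⟨z', hz', hmem _ z' hz' (hcov z' hz' hxz')⟩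
  exact hdisj w hw (hw1.2 x rfl) (hw2.2 _ rfl)

open Polynomial in
lemma properties_of_isPreconnected {D R : Subring F} [IsLocalRing D] (hDR : D ≤ R)
    {Z : Set (domSet D)} (hne : Z.Nonempty) (hZ : @IsClosed _ (zariskiTop (domSet D)) Z)
    (hZc : @IsPreconnected _ (zariskiTop (domSet D)) Z)
    (hR : ∀ x, x ∈ R ↔ ∀ z ∈ Z, x ∈ z.1) :
    IsLocalRing R ∧ Dominates R D ∧ ResiduallyAlgebraic D R ∧ IntegrallyClosedIn R := by
  obtain ⟨z₀, hz₀⟩ := hne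
  have hmax : ∀ x, x ∈ R → (MemMaxIdeal R x ↔ x ∈ (domSet.toValuationSubring z₀).nonunits) := by
    intro x hx
    rw [memMaxIdeal_iff, ValuationSubring.mem_nonunits_iff_or]
    refine ⟨fun h => h.2.imp_right fun h' h'' => h' ?_,
      fun h => ⟨hx, h.imp_right fun h' h'' => h' ((hR _).1 h'' z₀ hz₀)⟩⟩
    by_contra hxi
    rw [hR] at hxi
    push Not at hxi
    obtain ⟨w, hw, hxw⟩ := hxi
    have hwn : x ∈ (domSet.toValuationSubring w).nonunits := by
      rw [ValuationSubring.mem_nonunits_iff_or]; exact Or.inr hxw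
    have := domSet.mem_nonunits_of_mem_nonunits hZ hZc ((hR x).1 hx) hw hz₀ hwn
    rw [ValuationSubring.mem_nonunits_iff_or] at this
    rcases this with rfl | this
    · exact hxw (by rw [inv_zero]; exact w.1.zero_mem)
    · exact this h''
  refine ⟨IsLocalRing.of_nonunits_add fun a b ha hb => ?_, ⟨hDR, fun x hx => ?_⟩, fun x hx => ?_,
    integrallyClosedIn_iff.2 fun y hy => ?_⟩
  · have ha' := (hmax a a.2).1 ⟨a.2, ha⟩
    have hb' := (hmax b b.2).1 ⟨b.2, hb⟩
    exact ((hmax _ (a + b).2).2 (add_mem ha' hb')).2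
  · rw [hmax x (hDR hx), z₀.2.2.2 x hx]
    exact (domSet.toValuationSubring z₀).memMaxIdeal_iff
  · obtain ⟨P, hP, hPZ⟩ := (domSet.zarClosed_image hZ).exists_monic_forall_eval_mem_nonunits
      (domSet.forall_le_of_image _)
      (x := x) (by rintro _ ⟨w, hw, rfl⟩; exact (hR x).1 hx w hw)
    refine ⟨P.map D.subtype, hP.map _, fun i => by rw [coeff_map]; exact (P.coeff i).2, ?_⟩
    rw [eval_map]
    refine (hmax _ ((hR _).2 fun w hw => ?_)).2 (hPZ _ ⟨z₀, hz₀, rfl⟩)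
    exact (domSet.toValuationSubring w).nonunits_subset (hPZ _ ⟨w, hw, rfl⟩)
  · exact (hR y).2 fun w hw => (domSet.toValuationSubring w).mem_of_isIntegral
      (fun x hx => (hR x).1 hx w hw) hy

/-- **Valuative Connectedness Theorem.** Let `D` be a local subring of a field `F`.
A subring `R` of `F` containing `D` is a local ring dominating `D`, residually
algebraic over `D` and integrally closed in `F` if and only if `R` is the
intersection of the valuation rings in some nonempty closed and connected
subspace `Z` of `Dom_F(D)`. -/
theorem statement0 (D : Subring F) (hD : IsLocalRing D) (R : Subring F) (hDR : D ≤ R) :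
    (IsLocalRing R ∧ Dominates R D ∧ ResiduallyAlgebraic D R ∧ IntegrallyClosedIn R) ↔
      ∃ Z : Set ↥(domSet D), Z.Nonempty ∧
        @IsClosed _ (zariskiTop (domSet D)) Z ∧
        @IsConnected _ (zariskiTop (domSet D)) Z ∧
        (R : Set F) = ⋂ V ∈ Z, (V.1 : Set F) := by
  constructor
  · rintro ⟨hloc, hdom, hres, hint⟩
    exact ⟨domPointsOver D R, nonempty_domPointsOver hdom,
      domSet.isClosed_preimage (zarClosed_setOf_isCenteredOn hres),
      ⟨nonempty_domPointsOver hdom, isPreconnected_domPointsOver hdom hres hint⟩,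
      coe_eq_iInter_domPointsOver hdom hint⟩
  · rintro ⟨Z, hne, hcl, ⟨-, hconn⟩, hR⟩
    refine properties_of_isPreconnected hDR hne hcl hconn fun x => ?_
    rw [← SetLike.mem_coe, hR]
    simp
end

section
/- Let F be a field, D a subring of F, Z a nonempty subset of Zar_F(D), and let Z̄ be the closure of Z in the Zariski topology of Zar_F(D). Then J(Z) = J(Z̄), i.e. the intersection of the maximal ideals of the valuation rings in Z equals the intersection of the maximal ideals of the valuation rings in Z̄. -/
/-!
Common definitions: valuation rings of a field, the Zariski--Riemann space
`Zar_F(D)` with its Zariski and patch topologies, domination of local subrings,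
residual algebraicity, integral closedness, and projective models of `F/D`.
-/

variable {F : Type*} [Field F]

theorem memMaxIdeal_zero (R : Subring F) : MemMaxIdeal R 0 := by
  exact ⟨R.zero_mem, fun h => not_isUnit_zero (M₀ := R) h⟩

/-- A nonzero element of `F` lies in the maximal ideal of a valuation ring exactly when its
inverse does not lie in that ring. -/
theorem IsValSubring.memMaxIdeal_iff_inv_notMem {V : Subring F} (hV : IsValSubring V) {x : F}
    (hx : x ≠ 0) : MemMaxIdeal V x ↔ x⁻¹ ∉ V := by
  constructor
  · rintro ⟨h, hu⟩ hi
    exact hu (IsUnit.of_mul_eq_one ⟨x⁻¹, hi⟩ (Subtype.ext (mul_inv_cancel₀ hx)))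
  · intro hi
    refine ⟨(hV x hx).resolve_right hi, fun hu => hi ?_⟩
    obtain ⟨y, hy⟩ := hu.exists_right_inv
    rw [inv_eq_of_mul_eq_one_right (congrArg Subtype.val hy : x * y = 1)]
    exact y.2

theorem isClosed_setOf_memMaxIdeal (D : Subring F) (x : F) :
    @IsClosed _ (zariskiTop (zarSet D)) {V | MemMaxIdeal V.1 x} := by
  let := zariskiTop (zarSet D)
  rcases eq_or_ne x 0 with rfl | hx
  · simp [memMaxIdeal_zero]
  · rw [← isOpen_compl_iff]
    refine TopologicalSpace.isOpen_generateFrom_of_mem ⟨{x⁻¹}, ?_⟩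
    ext V
    simp [V.2.1.memMaxIdeal_iff_inv_notMem hx]

/-- For a nonempty subset `Z` of `Zar_F(D)` with Zariski closure `Z̄`, the
intersections of the maximal ideals of the valuation rings in `Z` and in `Z̄`
coincide: `J(Z) = J(Z̄)`. -/
theorem statement5 (D : Subring F) (Z : Set ↥(zarSet D)) (hZ : Z.Nonempty) :
    (⋂ V ∈ Z, {x : F | MemMaxIdeal V.1 x}) =
      ⋂ V ∈ @closure _ (zariskiTop (zarSet D)) Z, {x : F | MemMaxIdeal V.1 x} := by
  let := zariskiTop (zarSet D)
  ext x
  simp only [Set.mem_iInter]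
  exact ((isClosed_setOf_memMaxIdeal D x).closure_subset_iff (s := Z)).symm
end

section
/- Let F be a field and let D and R be local subrings of F such that R dominates D. Then R is residually algebraic over D if and only if Dom_F(R) is a closed subset of Dom_F(D) in the Zariski topology. -/
/-!
Common definitions: valuation rings of a field, the Zariski--Riemann space
`Zar_F(D)` with its Zariski and patch topologies, domination of local subrings,
residual algebraicity, integral closedness, and projective models of `F/D`.
-/

variable {F : Type*} [Field F]

/-- Domination amounts to inclusion of the rings together with inclusion of the maximal ideals. -/
lemma dominates_iff {R S : Subring F} :
    Dominates R S ↔ S ≤ R ∧ ∀ x, MemMaxIdeal S x → MemMaxIdeal R x := by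
  refine ⟨fun h ↦ ⟨h.1, fun x hx ↦ (h.2 x hx.1).1 hx⟩, fun h ↦ ⟨h.1, fun x hx ↦ ⟨h.2 x, ?_⟩⟩⟩
  simp only [memMaxIdeal_iff]
  exact fun hR ↦ ⟨hx, hR.2.imp_right fun h' hS ↦ h' (h.1 hS)⟩

lemma Dominates.trans {R S T : Subring F} (h₁ : Dominates R S) (h₂ : Dominates S T) :
    Dominates R T :=
  dominates_iff.2 ⟨h₂.1.trans h₁.1,
    fun x hx ↦ (dominates_iff.1 h₁).2 x ((dominates_iff.1 h₂).2 x hx)⟩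

lemma exists_valuationSubring_dominates (R : Subring F) [IsLocalRing R] :
    ∃ W : ValuationSubring F, Dominates W.toSubring R := by
  obtain ⟨W, hW, hloc⟩ := (LocalSubring.mk R).exists_le_valuationSubring
  refine ⟨W, dominates_iff.2 ⟨hW, fun x ⟨hx, hu⟩ ↦ ⟨hW hx, fun hu' ↦ hu ?_⟩⟩⟩
  exact hloc.map_nonunit ⟨x, hx⟩ hu'

lemma isOpen_zariskiTop_setOf_mem (X : Set (Subring F)) (a : F) :
    @IsOpen _ (zariskiTop X) {V : X | a ∈ V.1} :=
  TopologicalSpace.isOpen_generateFrom_of_mem ⟨{a}, by simp⟩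

/-- Zariski open sets are stable under passing to larger rings. -/
lemma mem_of_isOpen_zariskiTop {X : Set (Subring F)} {U : Set X} (hU : @IsOpen _ (zariskiTop X) U)
    {V W : X} (hVW : V.1 ≤ W.1) (hV : V ∈ U) : W ∈ U := by
  induction hU with
  | basic U hU =>
    obtain ⟨s, rfl⟩ := hU
    exact fun x hx ↦ hVW (hV x hx)
  | univ => trivial
  | inter A B _ _ hA hB => exact ⟨hA hV.1, hB hV.2⟩
  | sUnion S _ hS =>
    obtain ⟨A, hA, hVA⟩ := hV
    exact ⟨A, hA, hS A hA hVA⟩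

/-- The composite of a valuation ring `W` of `F` with a valuation ring of its residue field. -/
noncomputable def residueComposite (W : ValuationSubring F)
    (B : ValuationSubring (IsLocalRing.ResidueField W)) : Subring F :=
  (B.toSubring.comap (IsLocalRing.residue W)).map W.subtype

lemma mem_residueComposite {W : ValuationSubring F}
    {B : ValuationSubring (IsLocalRing.ResidueField W)} {x : F} :
    x ∈ residueComposite W B ↔ ∃ h : x ∈ W, IsLocalRing.residue W ⟨x, h⟩ ∈ B := by
  constructor
  · rintro ⟨⟨y, hy⟩, hyB, rfl⟩
    exact ⟨hy, hyB⟩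
  · rintro ⟨h, hB⟩
    exact ⟨⟨x, h⟩, hB, rfl⟩

lemma residueComposite_le (W : ValuationSubring F)
    (B : ValuationSubring (IsLocalRing.ResidueField W)) :
    residueComposite W B ≤ W.toSubring := fun _ hx ↦ (mem_residueComposite.1 hx).1

lemma mem_residueComposite_of_memMaxIdeal {W : ValuationSubring F}
    (B : ValuationSubring (IsLocalRing.ResidueField W)) {x : F}
    (hx : MemMaxIdeal W.toSubring x) : x ∈ residueComposite W B := by
  obtain ⟨h, hu⟩ := hx
  refine mem_residueComposite.2 ⟨h, ?_⟩
  have : IsLocalRing.residue W ⟨x, h⟩ = 0 := (IsLocalRing.residue_eq_zero_iff _).2 hu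
  exact this ▸ B.zero_mem

lemma isValSubring_residueComposite (W : ValuationSubring F)
    (B : ValuationSubring (IsLocalRing.ResidueField W)) :
    IsValSubring (residueComposite W B) := by
  intro x hx
  by_cases h : x ∈ W
  · by_cases h' : x⁻¹ ∈ W
    · have hinv : IsLocalRing.residue W ⟨x⁻¹, h'⟩ = (IsLocalRing.residue W ⟨x, h⟩)⁻¹ := by
        refine eq_inv_of_mul_eq_one_left ?_
        rw [← map_mul, ← map_one (IsLocalRing.residue W)]
        exact congrArg _ (Subtype.ext (inv_mul_cancel₀ hx))
      refine (B.mem_or_inv_mem (IsLocalRing.residue W ⟨x, h⟩)).imp ?_ ?_ <;> intro hB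
      · exact mem_residueComposite.2 ⟨h, hB⟩
      · exact mem_residueComposite.2 ⟨h', hinv ▸ hB⟩
    · exact .inl (mem_residueComposite_of_memMaxIdeal B (memMaxIdeal_iff.2 ⟨h, .inr h'⟩))
  · refine .inr (mem_residueComposite_of_memMaxIdeal B (memMaxIdeal_iff.2 ⟨?_, .inr ?_⟩))
    · exact (W.mem_or_inv_mem x).resolve_left h
    · rwa [inv_inv]

/-- If the residue class of `x` is not integral over `D`, some valuation ring inside `W` dominates
`D` and omits `x`. -/
lemma exists_mem_domSet_le_notMem {D : Subring F} {W : ValuationSubring F}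
    (hW : Dominates W.toSubring D) {x : F} (hx : x ∈ W)
    (hint : ∀ p : Polynomial F, p.Monic → (∀ i, p.coeff i ∈ D) →
      ¬ MemMaxIdeal W.toSubring (p.eval x)) :
    ∃ V ∈ domSet D, V ≤ W.toSubring ∧ x ∉ V := by
  let ι : D →+* W := Subring.inclusion hW.1
  let f : D →+* IsLocalRing.ResidueField W := (IsLocalRing.residue W).comp ι
  have hf : IsLocalRing.residue W ⟨x, hx⟩ ∉
      (integralClosure (Subring.closure (f.range : Set (IsLocalRing.ResidueField W)))
        (IsLocalRing.ResidueField W)).toSubring := by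
    rintro ⟨p, hp, hpx⟩
    have hlift : p.map (Subring.closure _).subtype ∈ Polynomial.lifts f := by
      refine (Polynomial.lifts_iff_coeff_lifts _).2 fun i ↦ ?_
      rw [Polynomial.coeff_map]
      exact (Subring.closure_eq f.range).le (p.coeff i).2
    obtain ⟨q, hq, -, hqm⟩ :=
      Polynomial.lifts_and_natDegree_eq_and_monic hlift (hp.map _)
    refine hint (q.map D.subtype) (hqm.map _) (fun i ↦ by simp) ?_
    have heval : (q.map D.subtype).eval x = ((q.eval₂ ι ⟨x, hx⟩ : W) : F) := by
      rw [Polynomial.eval_map]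
      exact (Polynomial.hom_eval₂ q ι W.subtype ⟨x, hx⟩).symm
    rw [heval]
    refine ⟨(q.eval₂ ι ⟨x, hx⟩).2, (IsLocalRing.residue_eq_zero_iff (R := W) _).1 ?_⟩
    refine (Polynomial.hom_eval₂ q ι (IsLocalRing.residue W) ⟨x, hx⟩).trans ?_
    change q.eval₂ f _ = 0
    rw [← Polynomial.eval_map, hq, Polynomial.eval_map]
    exact hpx
  rw [← iInf_valuationSubring_superset] at hf
  simp only [Subring.mem_iInf, not_forall] at hf
  obtain ⟨⟨B, hfB⟩, hxB⟩ := hf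
  refine ⟨residueComposite W B, ⟨isValSubring_residueComposite W B, dominates_iff.2
    ⟨fun d hd ↦ mem_residueComposite.2 ⟨hW.1 hd, hfB ⟨⟨d, hd⟩, rfl⟩⟩, fun d hd ↦ ?_⟩⟩,
    residueComposite_le W B, fun h ↦ hxB (mem_residueComposite.1 h).2⟩
  have hdW := (dominates_iff.1 hW).2 d hd
  exact memMaxIdeal_iff.2 ⟨mem_residueComposite_of_memMaxIdeal B hdW,
    (memMaxIdeal_iff.1 hdW).2.imp_right fun h h' ↦ h (residueComposite_le W B h')⟩

/-- A monic polynomial over a valuation ring has an invertible value with inverse in the ring at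
every element outside the ring. -/
lemma IsValSubring.inv_eval_mem {V : Subring F} (hV : IsValSubring V) {x : F} (hx : x ∉ V)
    {p : Polynomial F} (hp : p.Monic) (hpV : ∀ i, p.coeff i ∈ V) :
    p.eval x ≠ 0 ∧ (p.eval x)⁻¹ ∈ V := by
  by_contra h
  have hz : p.eval x ∈ V := by
    by_cases h0 : p.eval x = 0
    · exact h0 ▸ V.zero_mem
    · exact (hV _ h0).resolve_right fun h' ↦ h ⟨h0, h'⟩
  have hdeg : p.natDegree ≠ 0 := fun h0 ↦ h (by simp [hp.natDegree_eq_zero.1 h0, V.one_mem])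
  let B : ValuationSubring F := ⟨V, fun y ↦ by
    by_cases hy : y = 0
    · exact .inl (hy ▸ V.zero_mem)
    · exact hV y hy⟩
  have hlift : p - Polynomial.C (p.eval x) ∈ Polynomial.lifts (algebraMap B F) := by
    refine (Polynomial.lifts_iff_coeff_lifts _).2 fun i ↦ ?_
    have hi : (p - Polynomial.C (p.eval x)).coeff i ∈ V := by
      rw [Polynomial.coeff_sub, Polynomial.coeff_C]
      exact V.sub_mem (hpV i) (by split_ifs <;> simp [hz])
    exact ⟨⟨_, hi⟩, rfl⟩
  have hmonic : (p - Polynomial.C (p.eval x)).Monic := by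
    refine hp.sub_of_left (Polynomial.degree_C_le.trans_lt ?_)
    exact Polynomial.natDegree_pos_iff_degree_pos.1 (Nat.pos_of_ne_zero hdeg)
  obtain ⟨q, hq, -, hqm⟩ := Polynomial.lifts_and_natDegree_eq_and_monic hlift hmonic
  have hx_int : IsIntegral B x := ⟨q, hqm, by rw [← Polynomial.eval_map, hq]; simp⟩
  obtain ⟨y, rfl⟩ := IsIntegrallyClosed.isIntegral_iff.1 hx_int
  exact hx y.2

/-- Every valuation ring that dominates `D` but not `R` contains an element that no ring dominating
`R` contains. -/
lemma exists_mem_forall_dominates_notMem {D R V : Subring F} (halg : ResiduallyAlgebraic D R)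
    (hV : V ∈ domSet D) (hVR : ¬ Dominates V R) :
    ∃ a ∈ V, ∀ W : Subring F, Dominates W R → a ∉ W := by
  have key : ∃ b, MemMaxIdeal R b ∧ b ≠ 0 ∧ b⁻¹ ∈ V := by
    by_cases hle : R ≤ V
    · rw [dominates_iff, not_and] at hVR
      obtain ⟨b, hb, hbV⟩ := not_forall₂.1 (hVR hle)
      rw [memMaxIdeal_iff] at hbV
      push Not at hbV
      exact ⟨b, hb, hbV (hle hb.1)⟩
    · obtain ⟨x, hx, hxV⟩ := SetLike.not_le_iff_exists.1 hle
      obtain ⟨p, hp, hpD, hpx⟩ := halg x hx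
      exact ⟨p.eval x, hpx, hV.1.inv_eval_mem hxV hp fun i ↦ hV.2.1 (hpD i)⟩
  obtain ⟨b, hb, hb0, hbV⟩ := key
  exact ⟨b⁻¹, hbV, fun W hW ↦
    (memMaxIdeal_iff.1 ((dominates_iff.1 hW).2 b hb)).2.resolve_left hb0⟩

/-- Let `D` and `R` be local subrings of `F` with `R` dominating `D`. Then `R` is
residually algebraic over `D` if and only if `Dom_F(R)` is a Zariski closed subset
of `Dom_F(D)`. -/
theorem statement6 (D R : Subring F) (hD : IsLocalRing D) (hR : IsLocalRing R)
    (hdom : Dominates R D) :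
    ResiduallyAlgebraic D R ↔
      @IsClosed _ (zariskiTop (domSet D)) {V : ↥(domSet D) | Dominates V.1 R} := by
  let := zariskiTop (domSet D)
  constructor
  · refine fun halg ↦ ⟨isOpen_iff_forall_mem_open.2 fun V hV ↦ ?_⟩
    obtain ⟨a, haV, ha⟩ := exists_mem_forall_dominates_notMem halg V.2 hV
    exact ⟨_, fun W hW hWR ↦ ha W.1 hWR hW, isOpen_zariskiTop_setOf_mem _ a, haV⟩
  · intro hcl x hx
    by_contra! hint
    obtain ⟨W, hW⟩ := exists_valuationSubring_dominates R
    have hWD := hW.trans hdom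
    obtain ⟨V, hV, hVW, hxV⟩ := exists_mem_domSet_le_notMem hWD (hW.1 hx) fun p hp hpD hpx ↦ by
      have hpR : p.eval x ∈ R := by
        rw [Polynomial.eval_eq_sum]
        exact sum_mem fun i _ ↦ mul_mem (hdom.1 (hpD i)) (pow_mem hx i)
      exact hint p hp hpD ((hW.2 _ hpR).2 hpx)
    have hWdom : W.toSubring ∈ domSet D := ⟨fun y _ ↦ W.mem_or_inv_mem y, hWD⟩
    have hVR : ¬ Dominates V R := fun h ↦ hxV (h.1 hx)
    exact mem_of_isOpen_zariskiTop (V := ⟨V, hV⟩) (W := ⟨_, hWdom⟩) hcl.isOpen_compl hVW hVR hW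
end
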